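/- Let p ≥ 1 and let σ₁ ≥ σ₂ ≥ … ≥ σ_{2p} be real numbers. Then the following two subsets of ℝ^p coincide: (1) the set 𝒫₁ of decreasing p-tuples (ν₁ ≥ … ≥ ν_p) that are the ordered spectrum of a sum a + b of real symmetric p×p matrices a, b with ordered spectra σ₋ = (σ₁, σ₃, …, σ_{2p−1}) and σ₊ = (σ₂, σ₄, …, σ_{2p}) respectively; (2) the set 𝒫₂ of decreasing p-tuples (ν₁ ≥ … ≥ ν_p) such that the doubled list (ν₁, ν₁, ν₂, ν₂, …, ν_p, ν_p) is the ordered spectrum of a sum A + B of real symmetric 2p×2p matrices A, B each having ordered spectrum (σ₁, …, σ_{2p}). -/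

import Mathlib

open Matrix

namespace HornDoubling

/-- The span of the first `m` vectors of a finite sequence. -/
def flag {n : ℕ} {E : Type*} [AddCommGroup E] [Module ℝ E] (b : Fin n → E) (m : ℕ) :
    Submodule ℝ E :=
  Submodule.span ℝ (b '' {i | i.val < m})

open scoped Classical in
/-- The indices at which the dimension of `V ⊓ flag b m` jumps. -/
noncomputable def jumpSet {n : ℕ} {E : Type*} [AddCommGroup E] [Module ℝ E] (b : Fin n → E)
    (V : Submodule ℝ E) : Finset (Fin n) :=
  Finset.univ.filter fun i => ∃ v ∈ V, v - b i ∈ flag b i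

/-- The degree of a subspace with respect to a finite family of weighted flags. -/
noncomputable def degree {ι : Type*} [Fintype ι] {n : ℕ} {E : Type*} [AddCommGroup E] [Module ℝ E]
    (b : ι → Fin n → E) (σ : ι → Fin n → ℝ) (V : Submodule ℝ E) : ℝ :=
  ∑ s, ∑ i ∈ jumpSet (b s) V, σ s i

section Flags

variable {n : ℕ} {E : Type*} [AddCommGroup E] [Module ℝ E]

lemma mem_jumpSet {b : Fin n → E} {V : Submodule ℝ E} {i : Fin n} :
    i ∈ jumpSet b V ↔ ∃ v ∈ V, v - b i ∈ flag b i := by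
  simp [jumpSet]

lemma flag_mono (b : Fin n → E) {m k : ℕ} (h : m ≤ k) : flag b m ≤ flag b k :=
  Submodule.span_mono (Set.image_mono fun _ hi => lt_of_lt_of_le hi h)

lemma mem_flag (b : Fin n → E) {i : Fin n} {m : ℕ} (h : i.val < m) : b i ∈ flag b m :=
  Submodule.subset_span ⟨i, h, rfl⟩

lemma flag_zero (b : Fin n → E) : flag b 0 = ⊥ := by
  simp [flag]

lemma flag_succ (b : Fin n → E) (i : Fin n) :
    flag b (i.val + 1) = flag b i.val ⊔ Submodule.span ℝ {b i} := by
  rw [flag, flag, ← Submodule.span_union]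
  congr 1
  ext x
  simp only [Set.mem_image, Set.mem_ofPred_eq, Set.mem_union, Set.mem_singleton_iff]
  constructor
  · rintro ⟨j, hj, rfl⟩
    rcases Nat.lt_succ_iff_lt_or_eq.mp hj with h | h
    · exact Or.inl ⟨j, h, rfl⟩
    · exact Or.inr (by rw [Fin.ext h])
  · rintro (⟨j, hj, rfl⟩ | rfl)
    · exact ⟨j, by omega, rfl⟩
    · exact ⟨i, by omega, rfl⟩

lemma flag_le_iff {b : Fin n → E} {m : ℕ} {V : Submodule ℝ E} :
    flag b m ≤ V ↔ ∀ i : Fin n, i.val < m → b i ∈ V := by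
  rw [flag, Submodule.span_le, Set.image_subset_iff]
  rfl

lemma flag_top (b : Module.Basis (Fin n) ℝ E) {m : ℕ} (h : n ≤ m) : flag b m = ⊤ := by
  rw [eq_top_iff, ← b.span_eq, Submodule.span_le]
  rintro _ ⟨i, rfl⟩
  exact mem_flag _ (lt_of_lt_of_le i.2 h)

lemma mem_flag_iff (b : Module.Basis (Fin n) ℝ E) (m : ℕ) (x : E) :
    x ∈ flag b m ↔ ∀ i : Fin n, m ≤ i.val → b.repr x i = 0 := by
  rw [flag, b.mem_span_image]
  constructor
  · intro h i hi
    by_contra hne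
    have := h (Finsupp.mem_support_iff.mpr hne)
    simp at this
    omega
  · intro h i hi
    by_contra hne
    simp only [Set.mem_ofPred_eq, not_lt] at hne
    exact (Finsupp.mem_support_iff.mp hi) (h i hne)

lemma finrank_inf_flag (b : Module.Basis (Fin n) ℝ E) (V : Submodule ℝ E) {m : ℕ} (hm : m ≤ n) :
    Module.finrank ℝ (V ⊓ flag b m : Submodule ℝ E)
      = ((jumpSet b V).filter fun i => i.val < m).card := by
  have : FiniteDimensional ℝ E := b.finiteDimensional_of_finite
  induction m with
  | zero => simp [flag_zero]
  | succ m ih =>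
    specialize ih (by omega)
    let i : Fin n := ⟨m, hm⟩
    have hnot : b i ∉ flag b m := by
      rw [mem_flag_iff]
      push Not
      exact ⟨i, le_rfl, by simp⟩
    by_cases hi : i ∈ jumpSet b V
    · obtain ⟨v, hv, hvi⟩ := mem_jumpSet.mp hi
      have hvm : v ∉ flag b m := fun h => hnot (by
        have := Submodule.sub_mem _ h hvi
        simpa using this)
      have hsup : V ⊓ flag b (m + 1) = (V ⊓ flag b m) ⊔ Submodule.span ℝ {v} := by
        apply le_antisymm
        · rintro x ⟨hxV, hx⟩
          have hx' : x ∈ flag b m ⊔ Submodule.span ℝ {b i} := by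
            rw [← flag_succ b i]; exact hx
          obtain ⟨y, hy, z, hz, rfl⟩ := Submodule.mem_sup.mp hx'
          obtain ⟨c, rfl⟩ := Submodule.mem_span_singleton.mp hz
          refine Submodule.mem_sup.mpr ⟨y + c • b i - c • v, ⟨?_, ?_⟩, c • v,
            Submodule.smul_mem _ _ (Submodule.mem_span_singleton_self v), by abel⟩
          · exact Submodule.sub_mem _ hxV (Submodule.smul_mem _ _ hv)
          · have : y + c • b i - c • v = y - c • (v - b i) := by
              rw [smul_sub]; abel
            rw [this]
            exact Submodule.sub_mem _ hy (Submodule.smul_mem _ _ hvi)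
        · refine sup_le (inf_le_inf_left _ (flag_mono _ (by omega))) ?_
          rw [Submodule.span_singleton_le_iff_mem]
          refine ⟨hv, ?_⟩
          have h1 := flag_mono (b : Fin n → E) (Nat.le_succ m) hvi
          have h2 : b i ∈ flag b (m + 1) := mem_flag _ (Nat.lt_succ_self m)
          simpa using Submodule.add_mem _ h1 h2
      have hcard : ((jumpSet b V).filter fun j => j.val < m + 1)
          = insert i ((jumpSet b V).filter fun j => j.val < m) := by
        ext j
        simp only [Finset.mem_filter, Finset.mem_insert]
        constructor
        · rintro ⟨h1, h2⟩
          rcases Nat.lt_succ_iff_lt_or_eq.mp h2 with h | h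
          · exact Or.inr ⟨h1, h⟩
          · exact Or.inl (Fin.ext h)
        · rintro (rfl | ⟨h1, h2⟩)
          · exact ⟨hi, Nat.lt_succ_self m⟩
          · exact ⟨h1, by omega⟩
      rw [hcard, Finset.card_insert_of_notMem (by simp [i]), ← ih, hsup]
      have hdis : (V ⊓ flag b m) ⊓ Submodule.span ℝ {v} = ⊥ := by
        rw [Submodule.eq_bot_iff]
        rintro x ⟨⟨-, hx⟩, hx2⟩
        obtain ⟨c, rfl⟩ := Submodule.mem_span_singleton.mp hx2
        by_cases hc : c = 0
        · simp [hc]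
        · exact absurd ((Submodule.smul_mem_iff _ hc).mp hx) hvm
      have := Submodule.finrank_sup_add_finrank_inf_eq (V ⊓ flag b m) (Submodule.span ℝ {v})
      rw [hdis, finrank_bot, finrank_span_singleton (fun h => hvm (by rw [h]; exact Submodule.zero_mem _))] at this
      omega
    · have h1 : V ⊓ flag b (m + 1) = V ⊓ flag b m := by
        apply le_antisymm _ (inf_le_inf_left _ (flag_mono _ (by omega)))
        rintro x ⟨hxV, hx⟩
        refine ⟨hxV, ?_⟩
        have hx' : x ∈ flag b m ⊔ Submodule.span ℝ {b i} := by
          rw [← flag_succ b i]; exact hx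
        obtain ⟨y, hy, z, hz, rfl⟩ := Submodule.mem_sup.mp hx'
        obtain ⟨c, rfl⟩ := Submodule.mem_span_singleton.mp hz
        by_cases hc : c = 0
        · simpa [hc] using hy
        · exfalso
          apply hi
          refine mem_jumpSet.mpr ⟨c⁻¹ • (y + c • b i), Submodule.smul_mem _ _ hxV, ?_⟩
          rw [smul_add, smul_smul, inv_mul_cancel₀ hc, one_smul, add_sub_cancel_right]
          exact Submodule.smul_mem _ _ hy
      rw [h1, ih]
      congr 1
      ext j
      simp only [Finset.mem_filter]
      refine and_congr_right fun hj => ?_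
      have : j.val ≠ m := fun h => hi (by rwa [show i = j from Fin.ext h.symm])
      omega

lemma card_jumpSet (b : Module.Basis (Fin n) ℝ E) (V : Submodule ℝ E) :
    (jumpSet b V).card = Module.finrank ℝ V := by
  have := finrank_inf_flag b V le_rfl
  rw [flag_top b le_rfl, inf_top_eq] at this
  rw [this, Finset.filter_true_of_mem fun i _ => i.2]

lemma exists_reduced_adapted (b : Fin n → E) (V : Submodule ℝ E) :
    ∃ h : Fin n → E, (∀ i, i ∉ jumpSet b V → h i = b i) ∧ (∀ i ∈ jumpSet b V, h i ∈ V) ∧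
      ∀ i ∈ jumpSet b V, b i - h i ∈ Submodule.span ℝ (b '' {l | l < i ∧ l ∉ jumpSet b V}) := by
  have key : ∀ m : ℕ, m ≤ n →
      flag b m ≤ V ⊔ Submodule.span ℝ (b '' {l | l.val < m ∧ l ∉ jumpSet b V}) := by
    intro m
    induction m with
    | zero => simp [flag_zero]
    | succ m ih =>
      intro hm
      let i : Fin n := ⟨m, hm⟩
      have hmono : V ⊔ Submodule.span ℝ (b '' {l | l.val < m ∧ l ∉ jumpSet b V}) ≤
          V ⊔ Submodule.span ℝ (b '' {l | l.val < m + 1 ∧ l ∉ jumpSet b V}) :=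
        sup_le_sup_left (Submodule.span_mono (Set.image_mono <| by
          rintro l ⟨hl, hl'⟩
          exact ⟨Nat.lt_succ_of_lt hl, hl'⟩)) _
      have ih' := (ih (by omega)).trans hmono
      rw [show m + 1 = i.val + 1 from rfl, flag_succ b i]
      refine sup_le ih' ?_
      rw [Submodule.span_singleton_le_iff_mem]
      by_cases hi : i ∈ jumpSet b V
      · obtain ⟨v, hv, hvi⟩ := mem_jumpSet.mp hi
        have := Submodule.sub_mem _ (Submodule.mem_sup_left hv) (ih' hvi)
        rwa [sub_sub_cancel] at this
      · exact Submodule.mem_sup_right (Submodule.subset_span ⟨i, ⟨Nat.lt_succ_self m, hi⟩, rfl⟩)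
  have hex : ∀ i, ∃ h : E, (i ∉ jumpSet b V → h = b i) ∧ (i ∈ jumpSet b V → h ∈ V ∧
      b i - h ∈ Submodule.span ℝ (b '' {l | l < i ∧ l ∉ jumpSet b V})) := by
    intro i
    by_cases hi : i ∈ jumpSet b V
    · obtain ⟨v, hv, hvi⟩ := mem_jumpSet.mp hi
      have h1 := key i i.2.le hvi
      obtain ⟨y, hy, z, hz, hyz⟩ := Submodule.mem_sup.mp h1
      refine ⟨v - y, fun h => absurd hi h, fun _ => ⟨Submodule.sub_mem _ hv hy, ?_⟩⟩
      have : b i - (v - y) = -z := by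
        rw [show z = v - b i - y by rw [← hyz]; abel]
        abel
      rw [this]
      exact Submodule.neg_mem _ hz
    · exact ⟨b i, fun _ => rfl, fun h => absurd h hi⟩
  choose h h1 h2 using hex
  exact ⟨h, h1, fun i hi => (h2 i hi).1, fun i hi => (h2 i hi).2⟩

end Flags

lemma exists_weights {n : ℕ} (σ : Fin n → ℝ) :
    ∃ w : Fin n → ℝ, (∀ (m : Fin n) (hm : m.val + 1 < n), w m = σ m - σ ⟨m.val + 1, hm⟩) ∧
      ∀ i, σ i = ∑ m : Fin n, if i ≤ m then w m else 0 := by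
  let f : ℕ → ℝ := fun k => if h : k < n then σ ⟨k, h⟩ else 0
  refine ⟨fun m => f m - f (m + 1), fun m hm => by simp [f, hm], fun i => ?_⟩
  have key : ∀ k ≤ n, ∑ m ∈ Finset.range n, (if k ≤ m then f m - f (m + 1) else 0) = f k - f n := by
    intro k hk
    rw [← Finset.sum_filter]
    have : (Finset.range n).filter (fun m => k ≤ m) = Finset.Ico k n := by
      ext m; simp [and_comm]
    rw [this]
    have := Finset.sum_Ico_sub f hk
    rw [← neg_inj, ← Finset.sum_neg_distrib]
    simpa using this
  have h := key i i.2.le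
  rw [← Fin.sum_univ_eq_sum_range (fun m => if i.val ≤ m then f m - f (m + 1) else 0)] at h
  simpa [f] using h.symm

lemma sum_eq_sum_weights {n : ℕ} {σ w : Fin n → ℝ} (hw : ∀ i, σ i = ∑ m : Fin n, if i ≤ m then w m else 0)
    (I : Finset (Fin n)) :
    ∑ i ∈ I, σ i = ∑ m : Fin n, w m * (I.filter fun i => i.val < m.val + 1).card := by
  simp_rw [hw]
  rw [Finset.sum_comm]
  refine Finset.sum_congr rfl fun m _ => ?_
  rw [← Finset.sum_filter, Finset.sum_const, nsmul_eq_mul, mul_comm]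
  congr 3
  ext i
  simp

lemma sum_jumpSet {n : ℕ} {E : Type*} [AddCommGroup E] [Module ℝ E]
    {σ w : Fin n → ℝ} (hw : ∀ i, σ i = ∑ m : Fin n, if i ≤ m then w m else 0)
    (b : Module.Basis (Fin n) ℝ E) (V : Submodule ℝ E) :
    ∑ i ∈ jumpSet b V, σ i
      = ∑ m : Fin n, w m * Module.finrank ℝ (V ⊓ flag b (m.val + 1) : Submodule ℝ E) := by
  rw [sum_eq_sum_weights hw]
  refine Finset.sum_congr rfl fun m _ => ?_
  rw [finrank_inf_flag b V (by omega)]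

section Tensor

variable {n r : ℕ}

/-- The matrix of the tensor product of the linear maps given by the matrices `B j`. -/
def tensorMatrix (B : Fin r → Matrix (Fin n) (Fin n) ℝ) :
    Matrix (Fin r → Fin n) (Fin r → Fin n) ℝ :=
  Matrix.of fun c d => ∏ j, B j (c j) (d j)

lemma tensorMatrix_mul (B C : Fin r → Matrix (Fin n) (Fin n) ℝ) :
    tensorMatrix B * tensorMatrix C = tensorMatrix fun j => B j * C j := by
  ext c d
  simp only [tensorMatrix, Matrix.mul_apply, Matrix.of_apply, ← Finset.prod_mul_distrib]
  rw [Finset.prod_univ_sum, Fintype.piFinset_univ]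

lemma tensorMatrix_one : tensorMatrix (fun _ : Fin r => (1 : Matrix (Fin n) (Fin n) ℝ)) = 1 := by
  ext c d
  simp only [tensorMatrix, Matrix.of_apply, Matrix.one_apply]
  rw [Finset.prod_ite_zero]
  simp [funext_iff]

lemma tensorMatrix_transpose (B : Fin r → Matrix (Fin n) (Fin n) ℝ) :
    (tensorMatrix B)ᵀ = tensorMatrix fun j => (B j)ᵀ := by
  ext c d
  simp [tensorMatrix]

lemma tensorMatrix_update_apply (j : Fin r) (A : Matrix (Fin n) (Fin n) ℝ) (c d : Fin r → Fin n) :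
    tensorMatrix (Function.update (fun _ => 1) j A) c d
      = A (c j) (d j) * ∏ i ∈ Finset.univ.erase j, (1 : Matrix (Fin n) (Fin n) ℝ) (c i) (d i) := by
  rw [tensorMatrix, Matrix.of_apply, ← Finset.mul_prod_erase _ _ (Finset.mem_univ j),
    Function.update_self]
  congr 1
  refine Finset.prod_congr rfl fun i hi => ?_
  rw [Function.update_of_ne (Finset.ne_of_mem_erase hi)]

lemma tensorMatrix_update_sum {ι : Type*} [Fintype ι] (j : Fin r)
    (A : ι → Matrix (Fin n) (Fin n) ℝ) :
    tensorMatrix (Function.update (fun _ => 1) j (∑ s, A s))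
      = ∑ s, tensorMatrix (Function.update (fun _ => 1) j (A s)) := by
  ext c d
  simp only [tensorMatrix_update_apply, Matrix.sum_apply, Finset.sum_mul]

lemma tensorMatrix_update_diagonal (j : Fin r) (σ : Fin n → ℝ) :
    tensorMatrix (Function.update (fun _ => 1) j (diagonal σ)) = diagonal fun c => σ (c j) := by
  ext c d
  by_cases h : c = d
  · subst h
    simp [tensorMatrix_update_apply]
  · rw [diagonal_apply_ne _ h]
    obtain ⟨i, hi⟩ := Function.ne_iff.mp h
    rw [tensorMatrix, Matrix.of_apply]
    apply Finset.prod_eq_zero (Finset.mem_univ i)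
    by_cases hij : i = j
    · subst hij
      simp [hi]
    · simp [Function.update_of_ne hij, hi]

lemma det_mul_submatrix (g : Matrix (Fin n) (Fin n) ℝ) (T : Matrix (Fin n) (Fin r) ℝ)
    (c : Fin r → Fin n) :
    ((g * T).submatrix c id).det
      = (tensorMatrix (fun _ => g) *ᵥ fun d => (T.submatrix d id).det) c := by
  simp only [Matrix.mulVec, dotProduct, tensorMatrix, Matrix.of_apply]
  rw [← Matrix.det_transpose]
  simp only [← Matrix.det_transpose (T.submatrix _ _), Matrix.det_apply, Finset.mul_sum]
  rw [Finset.sum_comm]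
  refine Finset.sum_congr rfl fun π _ => ?_
  simp only [Matrix.transpose_apply, Matrix.submatrix_apply, id, Matrix.mul_apply]
  rw [Finset.prod_univ_sum, Fintype.piFinset_univ, Finset.smul_sum]
  refine Finset.sum_congr rfl fun d _ => ?_
  rw [Finset.prod_mul_distrib, mul_smul_comm]

/-- If a nonzero tensor `ω`, written in each of several orthonormal frames, only involves indices
dominated by `e s`, then the degree of `e` is nonpositive for weights whose sum of
self-adjoint matrices vanishes. -/
lemma sum_weights_nonpos_of_tensor {ι : Type*} [Fintype ι] {σ : ι → Fin n → ℝ}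
    (hσ : ∀ s, Antitone (σ s)) {Q : ι → Matrix (Fin n) (Fin n) ℝ} (hQ : ∀ s, (Q s)ᵀ * Q s = 1)
    (hsum : ∑ s, Q s * diagonal (σ s) * (Q s)ᵀ = 0) {e : ι → Fin r → Fin n}
    {ω : (Fin r → Fin n) → ℝ} (hω : ω ≠ 0) {τ : ι → (Fin r → Fin n) → ℝ}
    (hτ : ∀ s, ω = tensorMatrix (fun _ => Q s) *ᵥ τ s)
    (hgood : ∀ s c, τ s c ≠ 0 → ∃ π : Equiv.Perm (Fin r), ∀ i, c (π i) ≤ e s i) :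
    ∑ s, ∑ j, σ s (e s j) ≤ 0 := by
  have hK : ∀ s, (tensorMatrix fun _ : Fin r => Q s)ᵀ * tensorMatrix (fun _ => Q s) = 1 := by
    intro s
    rw [tensorMatrix_transpose, tensorMatrix_mul]
    simp_rw [hQ s]
    exact tensorMatrix_one
  have hback : ∀ s, τ s = (tensorMatrix fun _ : Fin r => Q s)ᵀ *ᵥ ω := by
    intro s
    rw [hτ s, Matrix.mulVec_mulVec, hK, Matrix.one_mulVec]
  have hnorm : ∀ s, τ s ⬝ᵥ τ s = ω ⬝ᵥ ω := by
    intro s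
    conv_lhs => rw [hback s]
    rw [Matrix.dotProduct_mulVec, Matrix.vecMul_transpose, ← hback, ← hτ s]
  have hslot : ∀ s j, ω ⬝ᵥ
      (tensorMatrix (Function.update (fun _ => 1) j (Q s * diagonal (σ s) * (Q s)ᵀ)) *ᵥ ω)
        = ∑ c, τ s c ^ 2 * σ s (c j) := by
    intro s j
    have h1 : tensorMatrix (Function.update (fun _ : Fin r => 1) j
        (Q s * diagonal (σ s) * (Q s)ᵀ)) = tensorMatrix (fun _ => Q s) *
          tensorMatrix (Function.update (fun _ => 1) j (diagonal (σ s))) *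
            (tensorMatrix fun _ => Q s)ᵀ := by
      rw [tensorMatrix_transpose, tensorMatrix_mul, tensorMatrix_mul]
      congr 1
      funext i
      by_cases hij : i = j
      · subst hij; simp
      · simp only [Function.update_of_ne hij, mul_one]
        exact (mul_eq_one_comm.mp (hQ s)).symm
    rw [h1, ← Matrix.mulVec_mulVec, ← Matrix.mulVec_mulVec, ← hback, tensorMatrix_update_diagonal,
      Matrix.dotProduct_mulVec, ← Matrix.mulVec_transpose, ← hback]
    simp only [dotProduct, Matrix.mulVec_diagonal]
    exact Finset.sum_congr rfl fun c _ => by ring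
  have hzero : ∑ s, ∑ j, ∑ c, τ s c ^ 2 * σ s (c j) = 0 := by
    simp_rw [← hslot]
    rw [Finset.sum_comm]
    refine Finset.sum_eq_zero fun j _ => ?_
    rw [← dotProduct_sum, ← Matrix.sum_mulVec, ← tensorMatrix_update_sum, hsum]
    have : tensorMatrix (Function.update (fun _ : Fin r => 1) j
        (0 : Matrix (Fin n) (Fin n) ℝ)) = 0 := by
      ext c d
      simp [tensorMatrix_update_apply]
    simp [this]
  have hpos : 0 < ω ⬝ᵥ ω := by
    refine lt_of_le_of_ne (by simpa using dotProduct_star_self_nonneg ω) fun h => hω ?_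
    exact dotProduct_self_eq_zero.mp h.symm
  have hle : (ω ⬝ᵥ ω) * ∑ s, ∑ j, σ s (e s j) ≤ 0 := by
    rw [← hzero, Finset.mul_sum]
    refine Finset.sum_le_sum fun s _ => ?_
    rw [← hnorm s, Finset.sum_comm, dotProduct, Finset.sum_mul]
    refine Finset.sum_le_sum fun c _ => ?_
    by_cases hc : τ s c = 0
    · simp [hc]
    · obtain ⟨π, hπ⟩ := hgood s c hc
      rw [← Finset.mul_sum, ← sq]
      refine mul_le_mul_of_nonneg_left ?_ (sq_nonneg _)
      rw [← Equiv.sum_comp π fun j => σ s (c j)]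
      exact Finset.sum_le_sum fun j _ => hσ s (hπ j)
  by_contra! h
  exact absurd hle (not_le.mpr (mul_pos hpos h))

end Tensor

/-- A linear system depending polynomially on a parameter which is degenerate for infinitely many
values of the parameter is degenerate for all of them. -/
lemma exists_mulVec_eq_zero_of_infinite {α β : Type*} [Fintype α] [Fintype β] [DecidableEq β]
    [DecidableEq α] (N : Matrix α β (Polynomial ℝ))
    (hN : {t : ℝ | ∃ v, v ≠ 0 ∧ N.map (Polynomial.eval t) *ᵥ v = 0}.Infinite) (t₀ : ℝ) :
    ∃ v, v ≠ 0 ∧ N.map (Polynomial.eval t₀) *ᵥ v = 0 := by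
  by_contra! hcon
  have hker : LinearMap.ker (Matrix.toLin' (N.map (Polynomial.eval t₀))) = ⊥ := by
    rw [LinearMap.ker_eq_bot']
    intro v hv
    by_contra hne
    exact hcon v hne (by simpa using hv)
  obtain ⟨L, hL⟩ := LinearMap.exists_leftInverse_of_injective _ hker
  set L' := LinearMap.toMatrix' L with hL'
  have hLN : L' * N.map (Polynomial.eval t₀) = 1 := by
    apply Matrix.toLin'.injective
    rw [Matrix.toLin'_mul, hL', Matrix.toLin'_toMatrix', hL, Matrix.toLin'_one]
  have heval : ∀ t : ℝ, Polynomial.eval t (L'.map Polynomial.C * N).det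
      = (L' * N.map (Polynomial.eval t)).det := by
    intro t
    rw [← Polynomial.coe_evalRingHom, RingHom.map_det, RingHom.mapMatrix_apply, Matrix.map_mul]
    congr 2
    ext i j
    simp
  have hz : (L'.map Polynomial.C * N).det = 0 := by
    refine Polynomial.eq_zero_of_infinite_isRoot _ (hN.mono ?_)
    rintro t ⟨v, hv, hNv⟩
    change Polynomial.eval t _ = 0
    rw [heval, ← Matrix.exists_mulVec_eq_zero_iff]
    exact ⟨v, hv, by rw [← Matrix.mulVec_mulVec, hNv, Matrix.mulVec_zero]⟩
  have := heval t₀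
  rw [hz, hLN] at this
  simp at this

/-- Local solvability of a matrix factorization problem along a line, from infinitesimal
solvability. -/
lemma eventually_exists_factorization {𝔸 : Type*} [NormedRing 𝔸] [NormedAlgebra ℝ 𝔸]
    [FiniteDimensional ℝ 𝔸] {ι : Type*} [Fintype ι] (h q : ι → 𝔸) (PY PZ : ι → 𝔸 →L[ℝ] 𝔸)
    (hsurj : ∀ T : ι → 𝔸, ∃ (X : 𝔸) (Y Z : ι → 𝔸),
      ∀ s, X * h s + h s * PY s (Y s) - h s * PZ s (Z s) = T s)
    {U : Set (𝔸 × (ι → 𝔸) × (ι → 𝔸))} (hU : U ∈ nhds 0) :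
    ∀ᶠ t : ℝ in nhds 0, ∃ x ∈ U, ∀ s, (1 + x.1) * h s * (1 + PY s (x.2.1 s))
      = ((1 - t) • h s + t • q s) * (1 + PZ s (x.2.2 s)) := by
  have : CompleteSpace 𝔸 := FiniteDimensional.complete ℝ 𝔸
  let F : ℝ × (𝔸 × (ι → 𝔸) × (ι → 𝔸)) → ℝ × (ι → 𝔸) := fun x => (x.1, fun s =>
    (1 + x.2.1) * h s * (1 + PY s (x.2.2.1 s))
      - ((1 - x.1) • h s + x.1 • q s) * (1 + PZ s (x.2.2.2 s)))
  have hF : ContDiff ℝ 1 F := by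
    refine contDiff_fst.prodMk (contDiff_pi.mpr fun s => ?_)
    fun_prop
  have hd := (hF.contDiffAt (x := 0)).hasStrictFDerivAt (by norm_num)
  have hval : ∀ v : ℝ × (𝔸 × (ι → 𝔸) × (ι → 𝔸)), fderiv ℝ F 0 v = (v.1, fun s =>
      v.2.1 * h s + h s * PY s (v.2.2.1 s) - v.1 • (q s - h s) - h s * PZ s (v.2.2.2 s)) := by
    intro v
    have h1 : HasDerivAt (fun t : ℝ => F (t • v)) (fderiv ℝ F 0 v) 0 := by
      have h2 : HasDerivAt (fun t : ℝ => t • v) v 0 := by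
        simpa using (hasDerivAt_id (0 : ℝ)).smul_const v
      have h3 : HasFDerivAt F (fderiv ℝ F 0) ((0 : ℝ) • v) := by
        rw [zero_smul]; exact hd.hasFDerivAt
      exact h3.comp_hasDerivAt 0 h2
    refine h1.unique (HasDerivAt.prodMk ?_ (hasDerivAt_pi.mpr fun s => ?_))
    · simpa using (hasDerivAt_id (0 : ℝ)).mul_const v.1
    · have hid := hasDerivAt_id (0 : ℝ)
      have a1 : HasDerivAt (fun t : ℝ => (1 + t • v.2.1) * h s) (v.2.1 * h s) 0 := by
        simpa using ((hid.smul_const v.2.1).const_add 1).mul_const (h s)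
      have a2 : HasDerivAt (fun t : ℝ => 1 + t • PY s (v.2.2.1 s)) (PY s (v.2.2.1 s)) 0 := by
        simpa using (hid.smul_const (PY s (v.2.2.1 s))).const_add 1
      have a3 : HasDerivAt (fun t : ℝ => 1 + t • PZ s (v.2.2.2 s)) (PZ s (v.2.2.2 s)) 0 := by
        simpa using (hid.smul_const (PZ s (v.2.2.2 s))).const_add 1
      have a4 : HasDerivAt (fun t : ℝ => (1 - t * v.1) • h s + (t * v.1) • q s)
          (v.1 • (q s - h s)) 0 := by
        have := (((hid.mul_const v.1).const_sub 1).smul_const (h s)).add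
          ((hid.mul_const v.1).smul_const (q s))
        refine this.congr_deriv ?_
        simp [smul_sub]; abel
      have := (a1.mul a2).sub (a4.mul a3)
      simp only [zero_smul, add_zero, mul_one, one_mul, zero_mul, sub_zero, one_smul] at this
      refine (this.congr_deriv (by abel)).congr_of_eventuallyEq (Filter.Eventually.of_forall ?_)
      intro t
      simp
  have hrange : (fderiv ℝ F 0).range = ⊤ := by
    rw [LinearMap.range_eq_top]
    rintro ⟨t, T⟩
    obtain ⟨X, Y, Z, hXYZ⟩ := hsurj fun s => T s + t • (q s - h s)
    refine ⟨(t, X, Y, Z), ?_⟩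
    change fderiv ℝ F 0 (t, X, Y, Z) = _
    rw [hval]
    refine Prod.ext rfl (funext fun s => ?_)
    have := hXYZ s
    change X * h s + h s * PY s (Y s) - t • (q s - h s) - h s * PZ s (Z s) = T s
    rw [sub_right_comm, this, add_sub_cancel_right]
  have hmap := hd.map_nhds_eq_of_surj hrange
  have hF0 : F 0 = 0 := by
    refine Prod.ext rfl (funext fun s => ?_)
    simp [F]
  have hU' : (Set.univ ×ˢ U : Set (ℝ × (𝔸 × (ι → 𝔸) × (ι → 𝔸)))) ∈ nhds 0 := prod_mem_nhds Filter.univ_mem hU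
  have himg : F '' (Set.univ ×ˢ U) ∈ nhds (0 : ℝ × (ι → 𝔸)) := by
    rw [← hF0, ← hmap]
    exact Filter.image_mem_map hU'
  have hcont : Filter.Tendsto (fun t : ℝ => ((t, 0) : ℝ × (ι → 𝔸))) (nhds 0) (nhds 0) := by
    have : Continuous fun t : ℝ => ((t, 0) : ℝ × (ι → 𝔸)) := by fun_prop
    exact this.tendsto 0
  filter_upwards [hcont himg] with t ht
  obtain ⟨⟨t', x⟩, ⟨-, hx⟩, hxt⟩ := ht
  have ht' : t' = t := congrArg Prod.fst hxt
  subst ht'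
  exact ⟨x, hx, fun s => sub_eq_zero.mp (congrFun (congrArg Prod.snd hxt) s)⟩

/-- The linear map on matrices which keeps the entries satisfying `p` and kills the other ones. -/
noncomputable def maskLinear {n : ℕ} (p : Fin n → Fin n → Prop) :
    Matrix (Fin n) (Fin n) ℝ →ₗ[ℝ] Matrix (Fin n) (Fin n) ℝ := by
  classical
  exact
  { toFun := fun Y => Matrix.of fun l m => if p l m then Y l m else 0
    map_add' := fun Y Z => by ext l m; by_cases h : p l m <;> simp [h]
    map_smul' := fun c Y => by ext l m; by_cases h : p l m <;> simp [h] }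

lemma maskLinear_apply_of {n : ℕ} {p : Fin n → Fin n → Prop} {l m : Fin n} (h : p l m)
    (Y : Matrix (Fin n) (Fin n) ℝ) : maskLinear p Y l m = Y l m := by
  simp [maskLinear, h]

lemma maskLinear_apply_of_not {n : ℕ} {p : Fin n → Fin n → Prop} {l m : Fin n} (h : ¬ p l m)
    (Y : Matrix (Fin n) (Fin n) ℝ) : maskLinear p Y l m = 0 := by
  simp [maskLinear, h]

lemma exists_dominated_of_det_ne_zero {n r : ℕ} {T : Matrix (Fin n) (Fin r) ℝ} {e : Fin r → Fin n}
    (hT : ∀ l j, e j < l → T l j = 0) {c : Fin r → Fin n} (hc : (T.submatrix c id).det ≠ 0) :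
    ∃ π : Equiv.Perm (Fin r), ∀ i, c (π i) ≤ e i := by
  rw [Matrix.det_apply] at hc
  obtain ⟨π, -, hπ⟩ := Finset.exists_ne_zero_of_sum_ne_zero hc
  refine ⟨π, fun i => ?_⟩
  by_contra! hlt
  apply hπ
  rw [Finset.prod_eq_zero (Finset.mem_univ i), smul_zero]
  exact hT _ _ hlt

lemma exists_tensor_of_infinite {ι : Type*} [Fintype ι] [Nonempty ι] {n r : ℕ}
    (h q : ι → Matrix (Fin n) (Fin n) ℝ) (good : ι → (Fin r → Fin n) → Prop)
    (hq : ∀ s, (q s).det ≠ 0)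
    (hinf : {t : ℝ | ∃ τ : ι → (Fin r → Fin n) → ℝ, τ ≠ 0 ∧ (∀ s c, τ s c ≠ 0 → good s c) ∧
      ∃ ω, ∀ s, ω = tensorMatrix (fun _ => (1 - t) • h s + t • q s) *ᵥ τ s}.Infinite) :
    ∃ τ : ι → (Fin r → Fin n) → ℝ, (∀ s c, τ s c ≠ 0 → good s c) ∧
      ∃ ω, ω ≠ 0 ∧ ∀ s, ω = tensorMatrix (fun _ => q s) *ᵥ τ s := by
  classical
  obtain ⟨s₀⟩ := ‹Nonempty ι›
  let K : ι → Matrix (Fin r → Fin n) (Fin r → Fin n) (Polynomial ℝ) := fun s =>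
    Matrix.of fun c d => ∏ j, ((1 - Polynomial.X) * Polynomial.C (h s (c j) (d j))
      + Polynomial.X * Polynomial.C (q s (c j) (d j)))
  have hK : ∀ s t, (K s).map (Polynomial.eval t)
      = tensorMatrix (fun _ => (1 - t) • h s + t • q s) := by
    intro s t
    ext c d
    simp only [K, tensorMatrix, Matrix.map_apply, Matrix.of_apply, Polynomial.eval_prod,
      Polynomial.eval_add, Polynomial.eval_mul, Polynomial.eval_sub, Polynomial.eval_one,
      Polynomial.eval_X, Polynomial.eval_C, Matrix.add_apply, Matrix.smul_apply, smul_eq_mul]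
  let N : Matrix ((ι × (Fin r → Fin n)) ⊕ (ι × (Fin r → Fin n))) (ι × (Fin r → Fin n))
      (Polynomial ℝ) := Matrix.of fun x y => Sum.elim
    (fun x => (if x.1 = y.1 then K x.1 x.2 y.2 else 0) - (if s₀ = y.1 then K s₀ x.2 y.2 else 0))
    (fun x => if x = y ∧ ¬ good x.1 x.2 then 1 else 0) x
  have hN : ∀ t v, N.map (Polynomial.eval t) *ᵥ v = Sum.elim
      (fun x => (tensorMatrix (fun _ => (1 - t) • h x.1 + t • q x.1) *ᵥ fun d => v (x.1, d)) x.2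
        - (tensorMatrix (fun _ => (1 - t) • h s₀ + t • q s₀) *ᵥ fun d => v (s₀, d)) x.2)
      (fun x => if good x.1 x.2 then 0 else v x) := by
    intro t v
    ext x
    rcases x with x | x
    · simp only [Sum.elim_inl, ← hK, Matrix.mulVec, dotProduct, Matrix.map_apply, N,
        Matrix.of_apply, Polynomial.eval_sub, sub_mul, Finset.sum_sub_distrib,
        Fintype.sum_prod_type, apply_ite (Polynomial.eval t), Polynomial.eval_zero, ite_mul,
        zero_mul]
      congr 1
      · rw [Finset.sum_eq_single x.1 (fun b _ hb => by simp [hb.symm]) (by simp)]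
        simp
      · rw [Finset.sum_eq_single s₀ (fun b _ hb => by simp [hb.symm]) (by simp)]
        simp
    · simp only [Sum.elim_inr, Matrix.mulVec, dotProduct, Matrix.map_apply, N,
        Matrix.of_apply, apply_ite (Polynomial.eval t), Polynomial.eval_zero, ite_mul,
        zero_mul, Polynomial.eval_one, one_mul]
      rw [Finset.sum_eq_single x (fun b _ hb => by simp [hb.symm]) (by simp)]
      by_cases hx : good x.1 x.2 <;> simp [hx]
  obtain ⟨v, hv, hNv⟩ := exists_mulVec_eq_zero_of_infinite N (hinf.mono (by
    rintro t ⟨τ, hτ, hgood, ω, hω⟩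
    refine ⟨fun x => τ x.1 x.2, fun h0 => hτ ?_, ?_⟩
    · funext s c
      exact congrFun h0 (s, c)
    · rw [hN]
      ext x
      rcases x with x | x
      · simp only [Sum.elim_inl, Pi.zero_apply]
        rw [← hω, ← hω, sub_self]
      · simp only [Sum.elim_inr, Pi.zero_apply, ite_eq_left_iff]
        intro hx
        by_contra hne
        exact hx (hgood _ _ hne))) 1
  rw [hN] at hNv
  have hq' : ∀ s, (1 - (1 : ℝ)) • h s + (1 : ℝ) • q s = q s := fun s => by simp
  simp only [hq'] at hNv
  have hω : ∀ s, (tensorMatrix (fun _ => q s₀) *ᵥ fun d => v (s₀, d))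
      = tensorMatrix (fun _ => q s) *ᵥ fun d => v (s, d) := by
    intro s
    funext c
    have := congrFun hNv (Sum.inl (s, c))
    simp only [Sum.elim_inl, Pi.zero_apply] at this
    exact (sub_eq_zero.mp this).symm
  refine ⟨fun s c => v (s, c), fun s c hne => ?_, _, fun h0 => hv ?_, hω⟩
  · have := congrFun hNv (Sum.inr (s, c))
    simp only [Sum.elim_inr, Pi.zero_apply, ite_eq_left_iff] at this
    by_contra hbad
    exact hne (this hbad)
  · funext ⟨s, c⟩
    have h1 := (hω s).symm.trans h0
    have h2 : (fun d => v (s, d)) = 0 := by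
      have h3 : tensorMatrix (fun _ : Fin r => (q s)⁻¹) * tensorMatrix (fun _ => q s) = 1 := by
        rw [tensorMatrix_mul]
        simp_rw [Matrix.nonsing_inv_mul (q s) (isUnit_iff_ne_zero.mpr (hq s))]
        exact tensorMatrix_one
      rw [← Matrix.one_mulVec (fun d => v (s, d)), ← h3, ← Matrix.mulVec_mulVec, h1,
        Matrix.mulVec_zero]
    exact congrFun h2 c

lemma eventually_exists_matrix_factorization {ι : Type*} [Fintype ι] {n : ℕ}
    (h q : ι → Matrix (Fin n) (Fin n) ℝ)
    (PY PZ : ι → Matrix (Fin n) (Fin n) ℝ →ₗ[ℝ] Matrix (Fin n) (Fin n) ℝ)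
    (hsurj : ∀ T : ι → Matrix (Fin n) (Fin n) ℝ, ∃ (X : Matrix (Fin n) (Fin n) ℝ)
      (Y Z : ι → Matrix (Fin n) (Fin n) ℝ),
      ∀ s, X * h s + h s * PY s (Y s) - h s * PZ s (Z s) = T s)
    {U : Set (Matrix (Fin n) (Fin n) ℝ × (ι → Matrix (Fin n) (Fin n) ℝ) ×
      (ι → Matrix (Fin n) (Fin n) ℝ))} (hU : U ∈ nhds 0) :
    ∀ᶠ t : ℝ in nhds 0, ∃ x ∈ U, ∀ s, (1 + x.1) * h s * (1 + PY s (x.2.1 s))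
      = ((1 - t) • h s + t • q s) * (1 + PZ s (x.2.2 s)) := by
  let _ : NormedRing (Matrix (Fin n) (Fin n) ℝ) := Matrix.linftyOpNormedRing
  let _ : NormedAlgebra ℝ (Matrix (Fin n) (Fin n) ℝ) := Matrix.linftyOpNormedAlgebra
  exact eventually_exists_factorization h q (fun s => (PY s).toContinuousLinearMap)
    (fun s => (PZ s).toContinuousLinearMap) hsurj hU

/-- If the positions of a common subspace with respect to several flags are unobstructed (the
surjectivity hypothesis), then the degree of this position is nonpositive for every balanced
system of weights. -/
theorem sum_weights_nonpos_of_surjective {ι : Type*} [Fintype ι] [Nonempty ι] {n r : ℕ}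
    (h : ι → Matrix (Fin n) (Fin n) ℝ) (hdet : ∀ s, (h s).det ≠ 0) (e : ι → Fin r → Fin n)
    (he : ∀ s, Function.Injective (e s)) (H : Matrix (Fin n) (Fin r) ℝ)
    (P : ι → Matrix (Fin r) (Fin r) ℝ) (hP : ∀ s, (P s).det ≠ 0)
    (hH : ∀ s, (h s).submatrix id (e s) = H * P s)
    (hsurj : ∀ T : ι → Matrix (Fin n) (Fin n) ℝ, ∃ X, ∀ s, ∀ l ∉ Set.range (e s), ∀ j, e s j < l →
      ((h s)⁻¹ * (T s - X * h s) : Matrix (Fin n) (Fin n) ℝ) l (e s j) = 0)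
    {σ : ι → Fin n → ℝ} (hσ : ∀ s, Antitone (σ s)) {Q : ι → Matrix (Fin n) (Fin n) ℝ}
    (hQ : ∀ s, (Q s)ᵀ * Q s = 1) (hsum : ∑ s, Q s * diagonal (σ s) * (Q s)ᵀ = 0) :
    ∑ s, ∑ j, σ s (e s j) ≤ 0 := by
  classical
  have hhu : ∀ s, IsUnit (h s).det := fun s => isUnit_iff_ne_zero.mpr (hdet s)
  let PY : ι → Matrix (Fin n) (Fin n) ℝ →ₗ[ℝ] Matrix (Fin n) (Fin n) ℝ := fun s =>
    maskLinear fun l m => ¬ (l ∉ Set.range (e s) ∧ m ∈ Set.range (e s))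
  let PZ : ι → Matrix (Fin n) (Fin n) ℝ →ₗ[ℝ] Matrix (Fin n) (Fin n) ℝ := fun s =>
    maskLinear fun l m => l ≤ m
  have hPYc : ∀ s, Continuous (PY s) := fun s => LinearMap.continuous_of_finiteDimensional _
  have hPZc : ∀ s, Continuous (PZ s) := fun s => LinearMap.continuous_of_finiteDimensional _
  have hPY : ∀ s Y, PY s Y = maskLinear
    (fun l m => ¬ (l ∉ Set.range (e s) ∧ m ∈ Set.range (e s))) Y := fun s Y => rfl
  have hPZ : ∀ s Y, PZ s Y = maskLinear (fun l m => l ≤ m) Y := fun s Y => rfl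
  let U : Set (Matrix (Fin n) (Fin n) ℝ × (ι → Matrix (Fin n) (Fin n) ℝ) ×
      (ι → Matrix (Fin n) (Fin n) ℝ)) :=
    {x | ∀ s, ((1 + PY s (x.2.1 s)).submatrix (e s) (e s)).det ≠ 0 ∧
      ((1 + PZ s (x.2.2 s)).submatrix (e s) (e s)).det ≠ 0}
  have hU : U ∈ nhds 0 := by
    have h1 : ∀ s, ((1 : Matrix (Fin n) (Fin n) ℝ).submatrix (e s) (e s)).det ≠ 0 := by
      intro s
      rw [Matrix.submatrix_one _ (he s), Matrix.det_one]
      exact one_ne_zero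
    refine Filter.eventually_all.mpr fun s => Filter.Eventually.and ?_ ?_
    · refine ContinuousAt.eventually_ne (Continuous.continuousAt ?_) (by simpa using h1 s)
      exact Continuous.matrix_det (Continuous.matrix_submatrix (continuous_const.add
        ((hPYc s).comp (by fun_prop))) _ _)
    · refine ContinuousAt.eventually_ne (Continuous.continuousAt ?_) (by simpa using h1 s)
      exact Continuous.matrix_det (Continuous.matrix_submatrix (continuous_const.add
        ((hPZc s).comp (by fun_prop))) _ _)
  have hfac := eventually_exists_matrix_factorization h Q PY PZ (fun T => by
    obtain ⟨X, hX⟩ := hsurj T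
    refine ⟨X, fun s => (h s)⁻¹ * (T s - X * h s),
      fun s => - maskLinear (fun l m => l ∉ Set.range (e s) ∧ m ∈ Set.range (e s))
        ((h s)⁻¹ * (T s - X * h s)), fun s => ?_⟩
    rw [hPY s, hPZ s]
    set W := (h s)⁻¹ * (T s - X * h s) with hW
    have hsplit : maskLinear
        (fun l m => ¬ (l ∉ Set.range (e s) ∧ m ∈ Set.range (e s))) W
        - maskLinear (fun l m => l ≤ m)
          (-maskLinear (fun l m => l ∉ Set.range (e s) ∧ m ∈ Set.range (e s)) W) = W := by
      ext l m
      rw [map_neg, sub_neg_eq_add, Matrix.add_apply]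
      by_cases h1 : l ∉ Set.range (e s) ∧ m ∈ Set.range (e s)
      · rw [maskLinear_apply_of_not (not_not.mpr h1), zero_add]
        by_cases h2 : l ≤ m
        · rw [maskLinear_apply_of (p := fun l m => l ≤ m) h2,
            maskLinear_apply_of (p := fun l m => l ∉ Set.range (e s) ∧ m ∈ Set.range (e s)) h1]
        · rw [maskLinear_apply_of_not (p := fun l m => l ≤ m) h2]
          obtain ⟨hl, j, rfl⟩ := h1
          exact (hX s l hl j (not_le.mp h2)).symm
      · rw [maskLinear_apply_of
            (p := fun l m => ¬ (l ∉ Set.range (e s) ∧ m ∈ Set.range (e s))) h1]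
        by_cases h2 : l ≤ m
        · rw [maskLinear_apply_of (p := fun l m => l ≤ m) h2, maskLinear_apply_of_not
            (p := fun l m => l ∉ Set.range (e s) ∧ m ∈ Set.range (e s)) h1, add_zero]
        · rw [maskLinear_apply_of_not (p := fun l m => l ≤ m) h2, add_zero]
    rw [add_sub_assoc, ← mul_sub, hsplit, hW, Matrix.mul_nonsing_inv_cancel_left _ _ (hhu s)]
    abel) hU
  have hQdet : ∀ s, (Q s).det ≠ 0 := fun s h0 => by
    have := congrArg Matrix.det (hQ s)
    rw [Matrix.det_mul, h0, mul_zero, Matrix.det_one] at this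
    exact zero_ne_one this
  obtain ⟨τ, hgood, ω, hω, hωτ⟩ := exists_tensor_of_infinite h Q
    (fun s c => ∃ π : Equiv.Perm (Fin r), ∀ i, c (π i) ≤ e s i) hQdet (by
    refine (infinite_of_mem_nhds 0 hfac).mono ?_
    rintro t ⟨⟨X, Y, Z⟩, hxU, hx⟩
    let D : ι → ℝ := fun s => (P s * (1 + PY s (Y s)).submatrix (e s) (e s)).det
    have hD : ∀ s, D s ≠ 0 := fun s => by
      rw [show D s = _ from Matrix.det_mul _ _]
      exact mul_ne_zero (hP s) (hxU s).1
    let T : ι → Matrix (Fin n) (Fin r) ℝ := fun s => (1 + PZ s (Z s)).submatrix id (e s)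
    refine ⟨fun s c => (D s)⁻¹ * ((T s).submatrix c id).det, fun h0 => ?_, fun s c hne => ?_,
      fun c => (((1 + X) * H).submatrix c id).det, fun s => ?_⟩
    · obtain ⟨s₀⟩ := ‹Nonempty ι›
      have := congrFun (congrFun h0 s₀) (e s₀)
      exact mul_ne_zero (inv_ne_zero (hD s₀)) (hxU s₀).2 this
    · refine exists_dominated_of_det_ne_zero (T := T s) (fun l j hlt => ?_)
        (right_ne_zero_of_mul hne)
      simp only [T, Matrix.submatrix_apply, id, Matrix.add_apply]
      rw [Matrix.one_apply_ne hlt.ne', zero_add, hPZ s, maskLinear_apply_of_not (p := fun l m => l ≤ m) (not_le.mpr hlt)]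
    · have hkey : ((1 - t) • h s + t • Q s) * T s
          = ((1 + X) * H) * (P s * (1 + PY s (Y s)).submatrix (e s) (e s)) := by
        have h1 : (1 + PY s (Y s)).submatrix id (e s)
            = (1 : Matrix (Fin n) (Fin n) ℝ).submatrix id (e s)
              * (1 + PY s (Y s)).submatrix (e s) (e s) := by
          ext l j
          by_cases hl : l ∈ Set.range (e s)
          · obtain ⟨i, rfl⟩ := hl
            rw [Matrix.mul_apply, Finset.sum_eq_single i]
            · rw [Matrix.submatrix_apply, Matrix.submatrix_apply, Matrix.submatrix_apply, id,
                Matrix.one_apply_eq, one_mul]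
            · intro b _ hb
              rw [Matrix.submatrix_apply, id, Matrix.one_apply_ne ((he s).ne hb.symm), zero_mul]
            · simp
          · have hlj : l ≠ e s j := fun h => hl ⟨j, h.symm⟩
            rw [Matrix.submatrix_apply, Matrix.add_apply, id, Matrix.one_apply_ne hlj, zero_add,
              hPY, maskLinear_apply_of_not (not_not.mpr ⟨hl, j, rfl⟩), Matrix.mul_apply]
            symm
            apply Finset.sum_eq_zero
            intro i _
            have hli : l ≠ e s i := fun h => hl ⟨i, h.symm⟩
            rw [Matrix.submatrix_apply, id, Matrix.one_apply_ne hli, zero_mul]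
        calc ((1 - t) • h s + t • Q s) * T s
            = (((1 - t) • h s + t • Q s) * (1 + PZ s (Z s))).submatrix id (e s) := by
              rw [Matrix.submatrix_mul _ _ id id (e s) Function.bijective_id, Matrix.submatrix_id_id]
          _ = ((1 + X) * h s * (1 + PY s (Y s))).submatrix id (e s) := by rw [← hx s]
          _ = (1 + X) * h s * (1 + PY s (Y s)).submatrix id (e s) := by
              rw [Matrix.submatrix_mul _ _ id id (e s) Function.bijective_id, Matrix.submatrix_id_id]
          _ = (1 + X) * (h s * (1 : Matrix (Fin n) (Fin n) ℝ).submatrix id (e s))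
              * (1 + PY s (Y s)).submatrix (e s) (e s) := by rw [h1]; simp only [Matrix.mul_assoc]
          _ = _ := by
              have : h s * (1 : Matrix (Fin n) (Fin n) ℝ).submatrix id (e s) = H * P s := by
                rw [← hH s]
                conv_rhs => rw [← Matrix.mul_one (h s)]
                rw [Matrix.submatrix_mul _ _ id id (e s) Function.bijective_id,
                  Matrix.submatrix_id_id]
              rw [this]; simp only [Matrix.mul_assoc]
      change _ = _ *ᵥ ((D s)⁻¹ • fun c => ((T s).submatrix c id).det)
      rw [Matrix.mulVec_smul]
      funext c
      have h2 := Matrix.submatrix_mul ((1 + X) * H)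
        (P s * (1 + PY s (Y s)).submatrix (e s) (e s)) c id id Function.bijective_id
      rw [Pi.smul_apply, ← det_mul_submatrix, hkey, h2, Matrix.submatrix_id_id, Matrix.det_mul,
        smul_eq_mul]
      change _ = (D s)⁻¹ * (_ * D s)
      rw [mul_comm, mul_assoc, mul_inv_cancel₀ (hD s), mul_one])
  exact sum_weights_nonpos_of_tensor hσ hQ hsum hω hωτ hgood

section Maximizer

variable {ι : Type*} [Fintype ι] {n : ℕ} {E : Type*} [AddCommGroup E] [Module ℝ E]

lemma finrank_map_add_finrank_ker_inf [FiniteDimensional ℝ E] {F : Type*} [AddCommGroup F]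
    [Module ℝ F] (f : E →ₗ[ℝ] F) (U : Submodule ℝ E) :
    Module.finrank ℝ (U.map f) + Module.finrank ℝ (LinearMap.ker f ⊓ U : Submodule ℝ E)
      = Module.finrank ℝ U := by
  have h := LinearMap.finrank_range_add_finrank_ker (f.domRestrict U)
  rw [LinearMap.range_domRestrict] at h
  rw [← h]
  congr 1
  rw [LinearMap.ker_domRestrict, inf_comm, ← Submodule.map_comap_subtype]
  exact Submodule.finrank_map_subtype_eq U _

/-- Comparison principle: a linear inequality between dimensions of intersections with all the
members of the flags, which is an equality for the whole space, gives one between degrees. -/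
lemma degree_add_le_degree_add {σ : ι → Fin n → ℝ} (hσ : ∀ s, Antitone (σ s))
    (b : ι → Module.Basis (Fin n) ℝ E) {U₁ U₂ V₁ V₂ : Submodule ℝ E}
    (hle : ∀ s m, Module.finrank ℝ (U₁ ⊓ flag (b s) m : Submodule ℝ E)
      + Module.finrank ℝ (U₂ ⊓ flag (b s) m : Submodule ℝ E)
      ≤ Module.finrank ℝ (V₁ ⊓ flag (b s) m : Submodule ℝ E)
      + Module.finrank ℝ (V₂ ⊓ flag (b s) m : Submodule ℝ E))
    (heq : Module.finrank ℝ U₁ + Module.finrank ℝ U₂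
      = Module.finrank ℝ V₁ + Module.finrank ℝ V₂) :
    degree (fun s => b s) σ U₁ + degree (fun s => b s) σ U₂
      ≤ degree (fun s => b s) σ V₁ + degree (fun s => b s) σ V₂ := by
  simp only [degree, ← Finset.sum_add_distrib]
  refine Finset.sum_le_sum fun s _ => ?_
  obtain ⟨w, hw, hσw⟩ := exists_weights (σ s)
  simp only [sum_jumpSet hσw, ← Finset.sum_add_distrib, ← mul_add]
  refine Finset.sum_le_sum fun m _ => ?_
  by_cases hm : m.val + 1 < n
  · refine mul_le_mul_of_nonneg_left (by exact_mod_cast hle s _) ?_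
    rw [hw m hm, sub_nonneg]
    exact hσ s (Fin.mk_le_mk.mpr (Nat.le_succ _))
  · rw [flag_top (b s) (not_lt.mp hm)]
    rw [inf_top_eq, inf_top_eq, inf_top_eq, inf_top_eq]
    refine le_of_eq ?_
    congr 1
    exact_mod_cast heq

lemma degree_supermodular {σ : ι → Fin n → ℝ} (hσ : ∀ s, Antitone (σ s)) [FiniteDimensional ℝ E]
    (b : ι → Module.Basis (Fin n) ℝ E) (U V : Submodule ℝ E) :
    degree (fun s => b s) σ U + degree (fun s => b s) σ V
      ≤ degree (fun s => b s) σ (U ⊔ V) + degree (fun s => b s) σ (U ⊓ V) := by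
  refine degree_add_le_degree_add hσ b (fun s m => ?_)
    (Submodule.finrank_sup_add_finrank_inf_eq U V).symm
  rw [← Submodule.finrank_sup_add_finrank_inf_eq]
  refine add_le_add (Submodule.finrank_mono ?_) (Submodule.finrank_mono ?_)
  · exact sup_le (inf_le_inf_right _ le_sup_left) (inf_le_inf_right _ le_sup_right)
  · exact le_inf (inf_le_inf inf_le_left inf_le_left) (inf_le_left.trans inf_le_right)

/-- There is a largest subspace of maximal degree. -/
lemma exists_largest_maximizer {σ : ι → Fin n → ℝ} (hσ : ∀ s, Antitone (σ s))
    [FiniteDimensional ℝ E] (b : ι → Module.Basis (Fin n) ℝ E) :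
    ∃ V : Submodule ℝ E, (∀ U, degree (fun s => b s) σ U ≤ degree (fun s => b s) σ V) ∧
      ∀ U, degree (fun s => b s) σ U = degree (fun s => b s) σ V → U ≤ V := by
  have hfin : (Set.range fun U : Submodule ℝ E => degree (fun s => b s) σ U).Finite := by
    refine (Set.finite_range fun J : ι → Finset (Fin n) => ∑ s, ∑ i ∈ J s, σ s i).subset ?_
    rintro _ ⟨U, rfl⟩
    exact ⟨fun s => jumpSet (b s) U, rfl⟩
  obtain ⟨_, ⟨V₀, rfl⟩, hV₀⟩ := Set.exists_max_image _ id hfin ⟨_, ⊥, rfl⟩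
  have hmax₀ : ∀ U, degree (fun s => b s) σ U ≤ degree (fun s => b s) σ V₀ :=
    fun U => hV₀ _ ⟨U, rfl⟩
  have hfin2 : ((fun U : Submodule ℝ E => Module.finrank ℝ U) ''
      {U | degree (fun s => b s) σ U = degree (fun s => b s) σ V₀}).Finite := by
    refine (Set.finite_Iic (Module.finrank ℝ E)).subset ?_
    rintro _ ⟨U, -, rfl⟩
    exact Submodule.finrank_le U
  obtain ⟨_, ⟨V, hV, rfl⟩, hVmax⟩ := Set.exists_max_image _ id hfin2 ⟨_, V₀, rfl, rfl⟩
  change degree _ σ V = degree _ σ V₀ at hV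
  refine ⟨V, fun U => hV ▸ hmax₀ U, fun U hU => ?_⟩
  have h1 := degree_supermodular hσ b U V
  have h2 := hmax₀ (U ⊔ V)
  have h3 := hmax₀ (U ⊓ V)
  have h4 : degree (fun s => b s) σ (U ⊔ V) = degree (fun s => b s) σ V₀ := by
    apply le_antisymm h2
    linarith
  have h5 : Module.finrank ℝ (U ⊔ V : Submodule ℝ E) ≤ Module.finrank ℝ V :=
    hVmax _ ⟨U ⊔ V, h4, rfl⟩
  have h6 := Submodule.eq_of_le_of_finrank_le (le_sup_right : V ≤ U ⊔ V) h5
  exact h6 ▸ le_sup_left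

/-- The largest subspace of maximal degree is infinitesimally rigid. -/
lemma map_mem_of_largest_maximizer {σ : ι → Fin n → ℝ} (hσ : ∀ s, Antitone (σ s))
    [FiniteDimensional ℝ E] (b : ι → Module.Basis (Fin n) ℝ E) {V : Submodule ℝ E}
    (hmax : ∀ U, degree (fun s => b s) σ U ≤ degree (fun s => b s) σ V)
    (hlargest : ∀ U, degree (fun s => b s) σ U = degree (fun s => b s) σ V → U ≤ V)
    (X : E →ₗ[ℝ] E) (hX : ∀ s m, ∀ x ∈ V ⊓ flag (b s) m, X x ∈ V ⊔ flag (b s) m) :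
    ∀ x ∈ V, X x ∈ V := by
  let K := V ⊓ V.comap X
  let V₂ := V ⊔ V.map X
  have hker : ∀ F, LinearMap.ker (V.mkQ ∘ₗ X) ⊓ (V ⊓ F) = K ⊓ F := by
    intro F
    rw [LinearMap.ker_comp, Submodule.ker_mkQ, ← inf_assoc, inf_comm (V.comap X)]
  have hker2 : ∀ F, LinearMap.ker V.mkQ ⊓ (V₂ ⊓ F) = V ⊓ F := by
    intro F
    rw [Submodule.ker_mkQ, ← inf_assoc, inf_eq_left.mpr (le_sup_left : V ≤ V₂)]
  have hcmp : ∀ F, (V ⊓ F).map (V.mkQ ∘ₗ X) ≤ (V₂ ⊓ F).map V.mkQ →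
      Module.finrank ℝ (V ⊓ F : Submodule ℝ E) + Module.finrank ℝ (V ⊓ F : Submodule ℝ E)
      ≤ Module.finrank ℝ (V₂ ⊓ F : Submodule ℝ E) + Module.finrank ℝ (K ⊓ F : Submodule ℝ E) := by
    intro F hF
    have h1 := finrank_map_add_finrank_ker_inf (V.mkQ ∘ₗ X) (V ⊓ F)
    have h2 := finrank_map_add_finrank_ker_inf V.mkQ (V₂ ⊓ F)
    rw [hker] at h1
    rw [hker2] at h2
    have h3 := Submodule.finrank_mono hF
    omega
  have hdeg := degree_add_le_degree_add (U₁ := V) (U₂ := V) (V₁ := V₂) (V₂ := K) hσ b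
    (fun s m => hcmp _ (by
      rintro _ ⟨x, hx, rfl⟩
      obtain ⟨v, hv, g, hg, hvg⟩ := Submodule.mem_sup.mp (hX s m x hx)
      refine ⟨g, ⟨?_, hg⟩, ?_⟩
      · have : g = X x - v := by rw [← hvg]; abel
        rw [this]
        exact Submodule.sub_mem _ (Submodule.mem_sup_right ⟨x, hx.1, rfl⟩)
          (Submodule.mem_sup_left hv)
      · rw [LinearMap.comp_apply, ← hvg, map_add, Submodule.mkQ_apply V v,
          (Submodule.Quotient.mk_eq_zero V).mpr hv, zero_add])) (by
    have h1 := finrank_map_add_finrank_ker_inf (V.mkQ ∘ₗ X) V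
    have h2 := finrank_map_add_finrank_ker_inf V.mkQ V₂
    have h3 := hker ⊤
    have h4 := hker2 ⊤
    simp only [inf_top_eq] at h3 h4
    rw [h3] at h1
    rw [h4] at h2
    have h5 : V₂.map V.mkQ = V.map (V.mkQ ∘ₗ X) := by
      rw [Submodule.map_sup, Submodule.map_comp, Submodule.mkQ_map_self, bot_sup_eq]
    rw [h5] at h2
    omega)
  have h1 := hmax V₂
  have h2 := hmax K
  have h3 : V₂ ≤ V := hlargest _ (le_antisymm h1 (by linarith))
  exact fun x hx => h3 (Submodule.mem_sup_right ⟨x, hx, rfl⟩)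

end Maximizer

/-- The pairs `(m, l)` with `m ∈ I`, `l ∉ I` and `m < l`; their number is the codimension of the
Schubert cell given by `I`. -/
def schubertPairs {n : ℕ} (I : Finset (Fin n)) : Finset (Fin n × Fin n) :=
  Finset.univ.filter fun q => q.1 ∈ I ∧ q.2 ∉ I ∧ q.1 < q.2

lemma mem_schubertPairs {n : ℕ} {I : Finset (Fin n)} {q : Fin n × Fin n} :
    q ∈ schubertPairs I ↔ q.1 ∈ I ∧ q.2 ∉ I ∧ q.1 < q.2 := by
  simp [schubertPairs]

section Rigid

variable {n : ℕ} {E : Type*} [AddCommGroup E] [Module ℝ E]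

/-- A basis whose flag is that of `b` and which contains a basis of `V`. -/
lemma exists_adapted_basis (b : Module.Basis (Fin n) ℝ E) (V : Submodule ℝ E) :
    ∃ h : Module.Basis (Fin n) ℝ E, (∀ m, flag h m = flag b m) ∧
      V = Submodule.span ℝ (h '' (jumpSet b V : Set (Fin n))) ∧
      ∀ i ∈ jumpSet b V, b i - h i ∈ Submodule.span ℝ (b '' {l | l < i ∧ l ∉ jumpSet b V}) := by
  have : FiniteDimensional ℝ E := b.finiteDimensional_of_finite
  obtain ⟨h, h1, h2, h3⟩ := exists_reduced_adapted (b : Fin n → E) V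
  have hdiff : ∀ i : Fin n, b i - h i ∈ flag b i := by
    intro i
    by_cases hi : i ∈ jumpSet b V
    · refine Submodule.span_mono ?_ (h3 i hi)
      refine Set.image_mono ?_
      rintro l ⟨hl, -⟩
      exact hl
    · rw [h1 i hi, sub_self]
      exact Submodule.zero_mem _
  have hle1 : ∀ m, flag h m ≤ flag b m := by
    intro m
    rw [flag_le_iff]
    intro i hi
    have := Submodule.sub_mem _ (mem_flag b hi) (flag_mono _ hi.le (hdiff i))
    simpa using this
  have hle2 : ∀ m, flag b m ≤ flag h m := by
    intro m
    induction m with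
    | zero => simp [flag_zero]
    | succ m ih =>
      rw [flag_le_iff]
      intro i hi
      have h4 : b i - h i ∈ flag h (m + 1) :=
        flag_mono _ (Nat.le_succ m) (ih (flag_mono _ (Nat.lt_succ_iff.mp hi) (hdiff i)))
      have := Submodule.add_mem _ h4 (mem_flag h hi)
      simpa using this
  have hspan : ⊤ ≤ Submodule.span ℝ (Set.range h) := by
    rw [← flag_top b le_rfl]
    exact (hle2 n).trans (Submodule.span_mono (Set.image_subset_range _ _))
  let hb := basisOfTopLeSpanOfCardEqFinrank h hspan
    (Module.finrank_eq_card_basis b).symm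
  have hhb : (hb : Fin n → E) = h := coe_basisOfTopLeSpanOfCardEqFinrank _ _ _
  refine ⟨hb, fun m => ?_, ?_, hhb ▸ h3⟩
  · rw [hhb]
    exact le_antisymm (hle1 m) (hle2 m)
  · symm
    apply Submodule.eq_of_le_of_finrank_le
    · rw [Submodule.span_le]
      rintro _ ⟨i, hi, rfl⟩
      rw [hhb]
      exact h2 i hi
    · rw [← card_jumpSet b V, Set.image_eq_range]
      have := finrank_span_eq_card (hb.linearIndependent.comp
        (fun i : ((jumpSet b V : Set (Fin n))) => i.1) Subtype.val_injective)
      change Module.finrank ℝ (Submodule.span ℝ (Set.range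
        (hb ∘ fun i : ((jumpSet b V : Set (Fin n))) => i.1))) = _ at this
      refine le_of_eq ?_
      have h5 : Fintype.card ((jumpSet b V : Set (Fin n))) = (jumpSet b V).card := by simp
      exact h5.symm.trans this.symm

lemma exists_comp_subtype_mkQ (V : Submodule ℝ E) (f : V →ₗ[ℝ] E ⧸ V) :
    ∃ X : E →ₗ[ℝ] E, V.mkQ ∘ₗ X ∘ₗ V.subtype = f := by
  obtain ⟨g, hg⟩ := LinearMap.exists_extend f
  obtain ⟨k, hk⟩ := V.mkQ.exists_rightInverse_of_surjective V.range_mkQ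
  refine ⟨k ∘ₗ g, ?_⟩
  rw [← LinearMap.comp_assoc, ← LinearMap.comp_assoc, hk, LinearMap.id_comp, hg]

/-- If the subspaces `V` of given position are infinitesimally rigid, of the expected dimension,
then the differential of the incidence map is onto. -/
lemma exists_repr_eq_of_rigid [FiniteDimensional ℝ E] {ι : Type*} [Fintype ι]
    (h : ι → Module.Basis (Fin n) ℝ E)
    (V : Submodule ℝ E) (J : ι → Finset (Fin n))
    (hJ : ∀ s, V = Submodule.span ℝ (h s '' (J s : Set (Fin n))))
    (hrigid : ∀ X : E →ₗ[ℝ] E, (∀ s m, ∀ x ∈ V ⊓ flag (h s) m, X x ∈ V ⊔ flag (h s) m) →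
      ∀ x ∈ V, X x ∈ V)
    (hcount : ∑ s, (schubertPairs (J s)).card
      ≤ Module.finrank ℝ V * (n - Module.finrank ℝ V))
    (t : ι → Fin n → Fin n → ℝ) :
    ∃ X : E →ₗ[ℝ] E, ∀ s, ∀ q ∈ schubertPairs (J s), (h s).repr (X (h s q.1)) q.2 = t s q.1 q.2 := by
  rcases isEmpty_or_nonempty ι with hι | ⟨⟨s₀⟩⟩
  · exact ⟨0, fun s => isEmptyElim s⟩
  have hn : Module.finrank ℝ E = n := by simp [Module.finrank_eq_card_basis (h s₀)]
  let L : (E →ₗ[ℝ] E) →ₗ[ℝ] ((Σ s, schubertPairs (J s)) → ℝ) :=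
    { toFun := fun X q => (h q.1).repr (X (h q.1 q.2.1.1)) q.2.1.2
      map_add' := fun X Y => by ext; simp
      map_smul' := fun c X => by ext; simp }
  let R : (E →ₗ[ℝ] E) →ₗ[ℝ] (V →ₗ[ℝ] E ⧸ V) :=
    { toFun := fun X => V.mkQ ∘ₗ X ∘ₗ V.subtype
      map_add' := fun X Y => by ext; simp
      map_smul' := fun c X => by ext; simp }
  have hR : LinearMap.range R = ⊤ := LinearMap.range_eq_top.mpr (exists_comp_subtype_mkQ V)
  have hker : LinearMap.ker L ≤ LinearMap.ker R := by
    intro X hX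
    have hX' : ∀ s, ∀ q ∈ schubertPairs (J s), (h s).repr (X (h s q.1)) q.2 = 0 :=
      fun s q hq => congrFun hX ⟨s, q, hq⟩
    have hXV := hrigid X (by
      rintro s m x ⟨hxV, hxm⟩
      have hxV' : x ∈ Submodule.span ℝ (h s '' (J s : Set (Fin n))) := (hJ s) ▸ hxV
      rw [(h s).mem_span_image] at hxV'
      rw [SetLike.mem_coe, mem_flag_iff] at hxm
      rw [← (h s).sum_repr x, map_sum]
      refine Submodule.sum_mem _ fun i _ => ?_
      rw [map_smul]
      by_cases hi0 : (h s).repr x i = 0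
      · rw [hi0, zero_smul]
        exact Submodule.zero_mem _
      have hiJ : i ∈ J s := by simpa using hxV' (Finsupp.mem_support_iff.mpr hi0)
      have him : i.val < m := by
        by_contra hc
        exact hi0 (hxm i (not_lt.mp hc))
      refine Submodule.smul_mem _ _ ?_
      rw [← (h s).sum_repr (X (h s i))]
      refine Submodule.sum_mem _ fun l _ => ?_
      by_cases hl : l ∈ J s
      · refine Submodule.smul_mem _ _ (Submodule.mem_sup_left ?_)
        rw [hJ s]
        exact Submodule.subset_span ⟨l, hl, rfl⟩
      rcases le_or_gt l i with hli | hli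
      · exact Submodule.smul_mem _ _ (Submodule.mem_sup_right
          (mem_flag _ (lt_of_le_of_lt hli him)))
      · rw [hX' s (i, l) (mem_schubertPairs.mpr ⟨hiJ, hl, hli⟩), zero_smul]
        exact Submodule.zero_mem _)
    rw [LinearMap.mem_ker]
    ext v
    exact (Submodule.Quotient.mk_eq_zero V).mpr (hXV v v.2)
  have h1 := LinearMap.finrank_range_add_finrank_ker L
  have h2 := LinearMap.finrank_range_add_finrank_ker R
  have h3 := Submodule.finrank_mono hker
  have h4 : Module.finrank ℝ (V →ₗ[ℝ] E ⧸ V)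
      = Module.finrank ℝ V * (n - Module.finrank ℝ V) := by
    rw [Module.finrank_linearMap, Submodule.finrank_quotient, hn]
  rw [hR, finrank_top, h4] at h2
  have h5 : Module.finrank ℝ ((Σ s, schubertPairs (J s)) → ℝ)
      = ∑ s, (schubertPairs (J s)).card := by
    simp [Module.finrank_fintype_fun_eq_card, Fintype.card_sigma]
  have hsurj : LinearMap.range L = ⊤ := by
    apply Submodule.eq_top_of_finrank_eq
    apply le_antisymm (Submodule.finrank_le _)
    rw [h5]
    omega
  obtain ⟨X, hX⟩ := LinearMap.range_eq_top.mp hsurj fun q => t q.1 q.2.1.1 q.2.1.2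
  exact ⟨X, fun s q hq => congrFun hX ⟨s, q, hq⟩⟩

/-- A rigid subspace of the expected position has nonpositive degree as soon as there is a balanced
family of symmetric matrices with the given spectra. -/
theorem degree_nonpos_of_rigid [FiniteDimensional ℝ E] {ι : Type*} [Fintype ι] [Nonempty ι]
    (b : ι → Module.Basis (Fin n) ℝ E) (V : Submodule ℝ E)
    (hrigid : ∀ X : E →ₗ[ℝ] E, (∀ s m, ∀ x ∈ V ⊓ flag (b s) m, X x ∈ V ⊔ flag (b s) m) →
      ∀ x ∈ V, X x ∈ V)
    (hcount : ∑ s, (schubertPairs (jumpSet (b s) V)).card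
      ≤ Module.finrank ℝ V * (n - Module.finrank ℝ V))
    {σ : ι → Fin n → ℝ} (hσ : ∀ s, Antitone (σ s)) {Q : ι → Matrix (Fin n) (Fin n) ℝ}
    (hQ : ∀ s, (Q s)ᵀ * Q s = 1) (hsum : ∑ s, Q s * diagonal (σ s) * (Q s)ᵀ = 0) :
    degree (fun s => b s) σ V ≤ 0 := by
  choose h hflag hJ _ using fun s => exists_adapted_basis (b s) V
  simp only [← hflag] at hrigid
  have hmain := exists_repr_eq_of_rigid h V _ hJ hrigid hcount
  let b₀ := b (Classical.arbitrary ι)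
  let e : ∀ s, Fin (Module.finrank ℝ V) → Fin n :=
    fun s => (jumpSet (b s) V).orderEmbOfFin (card_jumpSet (b s) V)
  have he : ∀ s, Function.Injective (e s) := fun s => (Finset.orderEmbOfFin _ _).injective
  have hrange : ∀ s, Set.range (e s) = jumpSet (b s) V :=
    fun s => Finset.range_orderEmbOfFin _ _
  have heV : ∀ s j, h s (e s j) ∈ V := by
    intro s j
    rw [hJ s]
    exact Submodule.subset_span ⟨_, (hrange s) ▸ Set.mem_range_self j, rfl⟩
  let v := Module.finBasis ℝ V
  let g : ∀ s, Fin (Module.finrank ℝ V) → V := fun s j => ⟨h s (e s j), heV s j⟩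
  have hg : ∀ s, LinearIndependent ℝ (g s) := by
    intro s
    refine LinearIndependent.of_comp V.subtype ?_
    exact (h s).linearIndependent.comp _ (he s)
  have hdet : ∀ (k : ℕ) (F : Type _) [AddCommGroup F] [Module ℝ F]
      (c d : Module.Basis (Fin k) ℝ F), (c.toMatrix d).det ≠ 0 := by
    intro k F _ _ c d hc
    have := congrArg Matrix.det (c.toMatrix_mul_toMatrix_flip d)
    rw [det_mul, hc, zero_mul, det_one] at this
    exact zero_ne_one this
  have key := sum_weights_nonpos_of_surjective (fun s => b₀.toMatrix (h s))
    (fun s => hdet _ _ _ _) e he (b₀.toMatrix fun j => (v j : E)) (fun s => v.toMatrix (g s))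
    (fun s => by
      have h1 := hdet _ _ v (Module.Basis.mk (hg s)
        ((hg s).span_eq_top_of_card_eq_finrank' (by simp)).ge)
      rwa [Module.Basis.coe_mk] at h1)
    (fun s => by
      ext i j
      have h1 : h s (e s j) = ∑ k, v.repr (g s j) k • (v k : E) := by
        have := congrArg V.subtype (v.sum_repr (g s j))
        rw [map_sum] at this
        exact this.symm
      rw [submatrix_apply, Module.Basis.toMatrix_apply, h1, mul_apply]
      simp [Module.Basis.toMatrix_apply, mul_comm])
    (fun T => by
      obtain ⟨X, hX⟩ := hmain fun s m l => ((b₀.toMatrix (h s))⁻¹ * T s : Matrix _ _ ℝ) l m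
      refine ⟨LinearMap.toMatrix b₀ b₀ X, fun s l hl j hj => ?_⟩
      have h1 := hX s (e s j, l) (mem_schubertPairs.mpr ⟨?_, ?_, hj⟩)
      · have h2 : (b₀.toMatrix (h s))⁻¹ * (LinearMap.toMatrix b₀ b₀ X * b₀.toMatrix (h s))
            = LinearMap.toMatrix (h s) (h s) X := by
          have h3 : (b₀.toMatrix (h s))⁻¹ = (h s).toMatrix b₀ :=
            inv_eq_left_inv ((h s).toMatrix_mul_toMatrix_flip b₀)
          rw [h3, ← Matrix.mul_assoc]
          exact basis_toMatrix_mul_linearMap_toMatrix_mul_basis_toMatrix _ _ _ _ _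
        rw [Matrix.mul_sub, h2, Matrix.sub_apply, LinearMap.toMatrix_apply, ← h1, sub_self]
      · rw [← Finset.mem_coe, ← hrange]
        exact Set.mem_range_self j
      · rw [← Finset.mem_coe, ← hrange]
        exact hl)
    hσ hQ hsum
  refine le_trans (le_of_eq ?_) key
  refine Finset.sum_congr rfl fun s _ => ?_
  rw [← Finset.sum_image (f := σ s) (he s).injOn]
  refine Finset.sum_congr ?_ fun _ _ => rfl
  ext i
  rw [← Finset.mem_coe, ← hrange]
  simp

end Rigid

/-- The interleaving of two copies of `Fin p`. -/
def interleave (p : ℕ) : Fin p ⊕ Fin p ≃ Fin (2 * p) where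
  toFun := Sum.elim (fun i => ⟨2 * i.val, by omega⟩) (fun i => ⟨2 * i.val + 1, by omega⟩)
  invFun j := if j.val % 2 = 0 then Sum.inl ⟨j.val / 2, by omega⟩
    else Sum.inr ⟨j.val / 2, by omega⟩
  left_inv := by
    rintro (i | i)
    · simp
    · have h : (2 * i.val + 1) / 2 = i.val := by omega
      simp [h]
  right_inv j := by
    by_cases h : j.val % 2 = 0
    · simp only [h, if_true, Sum.elim_inl, Fin.ext_iff]
      omega
    · simp only [h, if_false, Sum.elim_inr, Fin.ext_iff]
      omega

@[simp] lemma val_interleave_inl {p : ℕ} (i : Fin p) :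
    (interleave p (Sum.inl i)).val = 2 * i.val := rfl

@[simp] lemma val_interleave_inr {p : ℕ} (i : Fin p) :
    (interleave p (Sum.inr i)).val = 2 * i.val + 1 := rfl

/-- The union of the even copy of `I` and of the odd copy of `K`. -/
def interleaveFinset {p : ℕ} (I K : Finset (Fin p)) : Finset (Fin (2 * p)) :=
  (I.disjSum K).map (interleave p).toEmbedding

lemma interleave_inl_mem {p : ℕ} {I K : Finset (Fin p)} {i : Fin p} :
    interleave p (Sum.inl i) ∈ interleaveFinset I K ↔ i ∈ I := by
  simp [interleaveFinset]

lemma interleave_inr_mem {p : ℕ} {I K : Finset (Fin p)} {i : Fin p} :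
    interleave p (Sum.inr i) ∈ interleaveFinset I K ↔ i ∈ K := by
  simp [interleaveFinset]

lemma sum_interleaveFinset {p : ℕ} (I K : Finset (Fin p)) (f : Fin (2 * p) → ℝ) :
    ∑ j ∈ interleaveFinset I K, f j
      = ∑ i ∈ I, f (interleave p (Sum.inl i)) + ∑ i ∈ K, f (interleave p (Sum.inr i)) := by
  simp [interleaveFinset, Finset.sum_disjSum]

lemma sum_mul_eq_zero_of_sum_eq {p : ℕ} {a c : Fin p → ℤ} (ha : ∀ i, a i * a i = a i)
    (hc : ∀ i, c i * c i = c i) (hac : ∑ i, a i = ∑ i, c i) :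
    ∑ i, ∑ j, (if i < j then (a i - c i) * (a j - c j) else 0) + ∑ i, a i * (1 - c i) = 0 := by
  have h1 : (∑ i, (a i - c i)) * ∑ j, (a j - c j) = 0 := by
    rw [Finset.sum_sub_distrib, hac, sub_self, zero_mul]
  rw [Finset.sum_mul_sum] at h1
  have h2 : ∑ i, ∑ j, (a i - c i) * (a j - c j)
      = ∑ i, ∑ j, (if i < j then (a i - c i) * (a j - c j) else 0)
        + ∑ i, ∑ j, (if j < i then (a i - c i) * (a j - c j) else 0)
        + ∑ i, ∑ j, (if i = j then (a i - c i) * (a j - c j) else 0) := by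
    simp only [← Finset.sum_add_distrib]
    refine Finset.sum_congr rfl fun i _ => Finset.sum_congr rfl fun j _ => ?_
    rcases lt_trichotomy i j with h | h | h
    · simp [h, h.ne, h.not_gt]
    · simp [h]
    · simp [h, h.ne', h.not_gt]
  have h3 : ∑ i, ∑ j, (if j < i then (a i - c i) * (a j - c j) else 0)
      = ∑ i, ∑ j, (if i < j then (a i - c i) * (a j - c j) else 0) := by
    rw [Finset.sum_comm]
    refine Finset.sum_congr rfl fun i _ => Finset.sum_congr rfl fun j _ => ?_
    rw [mul_comm]
  have h4 : ∑ i, ∑ j, (if i = j then (a i - c i) * (a j - c j) else 0)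
      = 2 * ∑ i, a i * (1 - c i) := by
    have h5 : ∀ i, (a i - c i) * (a i - c i) = 2 * (a i * (1 - c i)) + (c i - a i) := by
      intro i
      linear_combination ha i + hc i
    simp only [Finset.sum_ite_eq, Finset.mem_univ, if_true, h5, Finset.sum_add_distrib,
      Finset.sum_sub_distrib, hac, sub_self, add_zero, Finset.mul_sum]
  rw [h2, h3, h4] at h1
  linarith

lemma card_schubertPairs {n : ℕ} (I : Finset (Fin n)) :
    ((schubertPairs I).card : ℤ) = ∑ i, ∑ j, if i < j then
      (if i ∈ I then 1 else 0) * (1 - (if j ∈ I then 1 else 0)) else 0 := by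
  rw [schubertPairs, Finset.card_filter, Fintype.sum_prod_type]
  push_cast
  refine Finset.sum_congr rfl fun i _ => Finset.sum_congr rfl fun j _ => ?_
  by_cases h1 : i ∈ I <;> by_cases h2 : j ∈ I <;> by_cases h3 : i < j <;> simp [h1, h2, h3]

lemma card_schubertPairs_interleaveFinset {p : ℕ} {I K : Finset (Fin p)} (hIK : I.card = K.card) :
    (schubertPairs (interleaveFinset I K)).card
      = 2 * ((schubertPairs I).card + (schubertPairs K).card) := by
  have hlt : ∀ x y : Fin (2 * p), x < y ↔ x.val < y.val := fun _ _ => Iff.rfl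
  let a : Fin p → ℤ := fun i => if i ∈ I then 1 else 0
  let c : Fin p → ℤ := fun i => if i ∈ K then 1 else 0
  have key := sum_mul_eq_zero_of_sum_eq (a := a) (c := c) (fun i => by simp [a])
    (fun i => by simp [c]) (by simp [a, c, hIK])
  zify
  simp only [card_schubertPairs]
  have hreindex : ∀ f : Fin (2 * p) → Fin (2 * p) → ℤ,
      ∑ x, ∑ y, f x y = ∑ x, ∑ y, f (interleave p x) (interleave p y) := by
    intro f
    rw [← (interleave p).sum_comp]
    exact Finset.sum_congr rfl fun x _ => ((interleave p).sum_comp _).symm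
  have ha : ∀ i, (if i ∈ I then (1 : ℤ) else 0) = a i := fun _ => rfl
  have hc : ∀ i, (if i ∈ K then (1 : ℤ) else 0) = c i := fun _ => rfl
  rw [hreindex]
  simp only [Fintype.sum_sum_type, interleave_inl_mem, interleave_inr_mem, hlt,
    val_interleave_inl, val_interleave_inr, ha, hc]
  refine sub_eq_zero.mp (Eq.trans ?_ key)
  have hdiag : ∑ i, a i * (1 - c i) = ∑ i, ∑ j, if i = j then a i * (1 - c j) else 0 := by
    simp
  rw [hdiag]
  simp only [Finset.mul_sum, ← Finset.sum_add_distrib, ← Finset.sum_sub_distrib]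
  refine Finset.sum_congr rfl fun i _ => Finset.sum_congr rfl fun j _ => ?_
  rcases lt_trichotomy i j with h | h | h
  · have h0 : i.val < j.val := h
    have h1 : 2 * i.val < 2 * j.val + 1 := by omega
    have h2 : 2 * i.val + 1 < 2 * j.val := by omega
    simp only [h, h0, h1, h2, h.ne, if_true, if_false, mul_lt_mul_iff_right₀, two_pos,
      add_lt_add_iff_right]
    ring
  · subst h
    simp
  · have h0 : ¬ i.val < j.val := not_lt.mpr h.le
    have h0' : j.val < i.val := h
    have h1 : ¬ 2 * i.val < 2 * j.val + 1 := by omega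
    have h2 : ¬ 2 * i.val + 1 < 2 * j.val := by omega
    simp only [h.not_gt, h0, h1, h2, h.ne', if_false, mul_lt_mul_iff_right₀, two_pos,
      add_lt_add_iff_right]
    ring

lemma sum_jumpSet_map {n : ℕ} {E : Type*} [AddCommGroup E] [Module ℝ E] (σ : Fin n → ℝ)
    (b c : Module.Basis (Fin n) ℝ E) (e : E ≃ₗ[ℝ] E) (U : Submodule ℝ E)
    (h : ∀ (m : Fin n) (hm : m.val + 1 < n), σ m ≠ σ ⟨m.val + 1, hm⟩ →
      (flag b (m.val + 1)).map (e : E →ₗ[ℝ] E) = flag c (m.val + 1)) :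
    ∑ i ∈ jumpSet c (U.map (e : E →ₗ[ℝ] E)), σ i = ∑ i ∈ jumpSet b U, σ i := by
  obtain ⟨w, hw, hσw⟩ := exists_weights σ
  rw [sum_jumpSet hσw, sum_jumpSet hσw]
  refine Finset.sum_congr rfl fun m _ => ?_
  by_cases hm : m.val + 1 < n
  · by_cases hs : σ m = σ ⟨m.val + 1, hm⟩
    · rw [hw m hm, hs, sub_self, zero_mul, zero_mul]
    · rw [← h m hm hs, ← Submodule.map_inf _ e.injective]
      congr 2
      exact LinearEquiv.finrank_map_eq e _
  · rw [flag_top b (not_lt.mp hm), flag_top c (not_lt.mp hm), inf_top_eq, inf_top_eq]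
    congr 2
    exact LinearEquiv.finrank_map_eq e _

section Doubling

variable {p : ℕ} {E : Type*} [AddCommGroup E] [Module ℝ E]

/-- The basis of `E × E` obtained by interleaving two bases of `E`. -/
noncomputable def interleaveBasis (b c : Module.Basis (Fin p) ℝ E) :
    Module.Basis (Fin (2 * p)) ℝ (E × E) :=
  (b.prod c).reindex (interleave p)

lemma interleaveBasis_repr_inl (b c : Module.Basis (Fin p) ℝ E) (x : E × E) (i : Fin p) :
    (interleaveBasis b c).repr x (interleave p (Sum.inl i)) = b.repr x.1 i := by
  simp [interleaveBasis]

lemma interleaveBasis_repr_inr (b c : Module.Basis (Fin p) ℝ E) (x : E × E) (i : Fin p) :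
    (interleaveBasis b c).repr x (interleave p (Sum.inr i)) = c.repr x.2 i := by
  simp [interleaveBasis]

lemma interleaveBasis_inl (b c : Module.Basis (Fin p) ℝ E) (i : Fin p) :
    interleaveBasis b c (interleave p (Sum.inl i)) = (b i, 0) := by
  simp [interleaveBasis]

lemma interleaveBasis_inr (b c : Module.Basis (Fin p) ℝ E) (i : Fin p) :
    interleaveBasis b c (interleave p (Sum.inr i)) = (0, c i) := by
  simp [interleaveBasis]

lemma flag_interleaveBasis (b c : Module.Basis (Fin p) ℝ E) (m : ℕ) :
    flag (interleaveBasis b c) m = (flag b ((m + 1) / 2)).prod (flag c (m / 2)) := by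
  ext x
  rw [mem_flag_iff, Submodule.mem_prod, mem_flag_iff, mem_flag_iff, ← (interleave p).forall_congr_right]
  rw [Sum.forall]
  simp only [interleaveBasis_repr_inl, interleaveBasis_repr_inr, val_interleave_inl,
    val_interleave_inr]
  refine and_congr (forall_congr' fun i => ?_) (forall_congr' fun i => ?_)
  · rw [show m ≤ 2 * i.val ↔ (m + 1) / 2 ≤ i.val by omega]
  · rw [show m ≤ 2 * i.val + 1 ↔ m / 2 ≤ i.val by omega]

lemma jumpSet_interleaveBasis (b c : Module.Basis (Fin p) ℝ E) (V : Submodule ℝ E) :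
    jumpSet (interleaveBasis b c) (V.prod V) = interleaveFinset (jumpSet b V) (jumpSet c V) := by
  ext j
  obtain ⟨x, rfl⟩ := (interleave p).surjective j
  rcases x with i | i
  · rw [interleave_inl_mem, mem_jumpSet, mem_jumpSet]
    simp only [interleaveBasis_inl, flag_interleaveBasis, val_interleave_inl, Submodule.mem_prod]
    rw [show (2 * i.val + 1) / 2 = i.val by omega]
    constructor
    · rintro ⟨v, hv, h1, -⟩
      exact ⟨v.1, hv.1, h1⟩
    · rintro ⟨v, hv, h1⟩
      exact ⟨(v, 0), ⟨hv, Submodule.zero_mem _⟩, h1, by simp⟩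
  · rw [interleave_inr_mem, mem_jumpSet, mem_jumpSet]
    simp only [interleaveBasis_inr, flag_interleaveBasis, val_interleave_inr, Submodule.mem_prod]
    rw [show (2 * i.val + 1) / 2 = i.val by omega]
    constructor
    · rintro ⟨v, hv, -, h1⟩
      exact ⟨v.2, hv.2, h1⟩
    · rintro ⟨v, hv, h1⟩
      exact ⟨(0, v), ⟨Submodule.zero_mem _, hv⟩, by simp, h1⟩

lemma map_prodComm_prod (V W : Submodule ℝ E) :
    (V.prod W).map (LinearEquiv.prodComm ℝ E E : E × E →ₗ[ℝ] E × E) = W.prod V := by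
  ext x
  simp only [Submodule.mem_map, Submodule.mem_prod, LinearEquiv.coe_coe, LinearEquiv.prodComm_apply]
  constructor
  · rintro ⟨y, hy, rfl⟩
    exact ⟨hy.2, hy.1⟩
  · intro hx
    exact ⟨x.swap, ⟨hx.2, hx.1⟩, by simp⟩

lemma flag_map_basis {n : ℕ} {F : Type*} [AddCommGroup F] [Module ℝ F]
    (b : Module.Basis (Fin n) ℝ F) (e : F ≃ₗ[ℝ] F) (m : ℕ) :
    flag (b.map e) m = (flag b m).map (e : F →ₗ[ℝ] F) := by
  rw [flag, flag, Submodule.map_span, ← Set.image_comp]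
  rfl

lemma jumpSet_map_basis {n : ℕ} {F : Type*} [AddCommGroup F] [Module ℝ F]
    (b : Module.Basis (Fin n) ℝ F) (e : F ≃ₗ[ℝ] F) (V : Submodule ℝ F) :
    jumpSet (b.map e) (V.map (e : F →ₗ[ℝ] F)) = jumpSet b V := by
  ext i
  rw [mem_jumpSet, mem_jumpSet, flag_map_basis]
  constructor
  · rintro ⟨_, ⟨v, hv, rfl⟩, w, hw, h⟩
    refine ⟨v, hv, ?_⟩
    have : e w = e (v - b i) := by simpa using h
    rwa [← e.injective this]
  · rintro ⟨v, hv, h⟩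
    exact ⟨e v, ⟨v, hv, rfl⟩, v - b i, h, by simp⟩

/-- The three doubled bases. -/
noncomputable def doubledBasis (b : Fin 3 → Module.Basis (Fin p) ℝ E) :
    Fin 3 → Module.Basis (Fin (2 * p)) ℝ (E × E) :=
  ![interleaveBasis (b 0) (b 1),
    (interleaveBasis (b 0) (b 1)).map (LinearEquiv.prodComm ℝ E E),
    interleaveBasis (b 2) (b 2)]

lemma sum_schubertPairs_doubledBasis (b : Fin 3 → Module.Basis (Fin p) ℝ E) (V : Submodule ℝ E) :
    ∑ s, (schubertPairs (jumpSet (doubledBasis b s) (V.prod V))).card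
      = 4 * ∑ s, (schubertPairs (jumpSet (b s) V)).card := by
  have h1 : jumpSet (doubledBasis b 1) (V.prod V) = jumpSet (doubledBasis b 0) (V.prod V) := by
    have := jumpSet_map_basis (interleaveBasis (b 0) (b 1)) (LinearEquiv.prodComm ℝ E E) (V.prod V)
    rwa [map_prodComm_prod] at this
  have h0 : jumpSet (doubledBasis b 0) (V.prod V) = _ := jumpSet_interleaveBasis (b 0) (b 1) V
  have h2 : jumpSet (doubledBasis b 2) (V.prod V) = _ := jumpSet_interleaveBasis (b 2) (b 2) V
  rw [Fin.sum_univ_three, Fin.sum_univ_three, h1, h0, h2,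
    card_schubertPairs_interleaveFinset, card_schubertPairs_interleaveFinset rfl]
  · ring
  · rw [card_jumpSet, card_jumpSet]

lemma degree_doubledBasis (b : Fin 3 → Module.Basis (Fin p) ℝ E) (V : Submodule ℝ E)
    (σ : Fin (2 * p) → ℝ) (τ : Fin p → ℝ) :
    degree (fun s => doubledBasis b s) ![σ, σ, fun j => τ ⟨j.val / 2, by omega⟩] (V.prod V)
      = 2 * degree (fun s => b s) ![fun i => σ (interleave p (Sum.inl i)),
        fun i => σ (interleave p (Sum.inr i)), τ] V := by
  have h1 : jumpSet (doubledBasis b 1) (V.prod V) = jumpSet (doubledBasis b 0) (V.prod V) := by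
    have := jumpSet_map_basis (interleaveBasis (b 0) (b 1)) (LinearEquiv.prodComm ℝ E E) (V.prod V)
    rwa [map_prodComm_prod] at this
  have h0 : jumpSet (doubledBasis b 0) (V.prod V) = _ := jumpSet_interleaveBasis (b 0) (b 1) V
  have h2 : jumpSet (doubledBasis b 2) (V.prod V) = _ := jumpSet_interleaveBasis (b 2) (b 2) V
  have h3 : ∀ i : Fin p, (2 * i.val + 1) / 2 = i.val := fun i => by omega
  simp only [degree, Fin.sum_univ_three, h1, h0, h2, sum_interleaveFinset]
  simp [h3]
  ring

/-- The degree with respect to the doubled bases is invariant under the two basic symmetries. -/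
lemma degree_doubledBasis_map_prodComm (b : Fin 3 → Module.Basis (Fin p) ℝ E)
    (U : Submodule ℝ (E × E)) (σ : Fin (2 * p) → ℝ) (τ : Fin p → ℝ) :
    degree (fun s => doubledBasis b s) ![σ, σ, fun j => τ ⟨j.val / 2, by omega⟩]
        (U.map (LinearEquiv.prodComm ℝ E E : E × E →ₗ[ℝ] E × E))
      = degree (fun s => doubledBasis b s) ![σ, σ, fun j => τ ⟨j.val / 2, by omega⟩] U := by
  have h0 := sum_jumpSet_map σ (doubledBasis b 1) (doubledBasis b 0) (LinearEquiv.prodComm ℝ E E) U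
    (fun m _ _ => by
      change (flag ((interleaveBasis (b 0) (b 1)).map (LinearEquiv.prodComm ℝ E E)) _).map _
        = flag (interleaveBasis (b 0) (b 1)) _
      rw [flag_map_basis, flag_interleaveBasis, map_prodComm_prod, map_prodComm_prod])
  have h1 := sum_jumpSet_map σ (doubledBasis b 0) (doubledBasis b 1) (LinearEquiv.prodComm ℝ E E) U
    (fun m _ _ => (flag_map_basis (interleaveBasis (b 0) (b 1)) _ _).symm)
  have h2 := sum_jumpSet_map (fun j => τ ⟨j.val / 2, by omega⟩) (doubledBasis b 2)
    (doubledBasis b 2) (LinearEquiv.prodComm ℝ E E) U (fun m hm hne => by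
      change (flag (interleaveBasis (b 2) (b 2)) _).map _ = flag (interleaveBasis (b 2) (b 2)) _
      have hodd : (m.val + 1 + 1) / 2 = (m.val + 1) / 2 := by
        by_contra hc
        apply hne
        congr 2
        simp only
        omega
      rw [flag_interleaveBasis, map_prodComm_prod, hodd])
  simp only [degree, Fin.sum_univ_three]
  change _ + _ + _ = _ + _ + _
  rw [← add_comm (∑ i ∈ jumpSet (doubledBasis b 1) U, _)]
  exact congrArg₂ _ (congrArg₂ _ h0 h1) h2

/-- The reflection `(x, y) ↦ (x, -y)`. -/
def negSnd (E : Type*) [AddCommGroup E] [Module ℝ E] : (E × E) ≃ₗ[ℝ] (E × E) :=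
  (LinearEquiv.refl ℝ E).prodCongr (LinearEquiv.neg ℝ)

lemma negSnd_apply (x : E × E) : negSnd E x = (x.1, -x.2) := rfl

lemma degree_doubledBasis_map_neg (b : Fin 3 → Module.Basis (Fin p) ℝ E)
    (U : Submodule ℝ (E × E)) (σ : Fin 3 → Fin (2 * p) → ℝ) :
    degree (fun s => doubledBasis b s) σ
        (U.map (negSnd E : E × E →ₗ[ℝ] E × E))
      = degree (fun s => doubledBasis b s) σ U := by
  have hprod : ∀ V W : Submodule ℝ E, (V.prod W).map
      (negSnd E : E × E →ₗ[ℝ] E × E) = V.prod W := by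
    intro V W
    ext x
    simp only [Submodule.mem_map, Submodule.mem_prod, LinearEquiv.coe_coe]
    constructor
    · rintro ⟨y, hy, rfl⟩
      exact ⟨hy.1, Submodule.neg_mem _ hy.2⟩
    · intro hx
      exact ⟨(x.1, -x.2), ⟨hx.1, Submodule.neg_mem _ hx.2⟩, by simp [negSnd_apply]⟩
  refine Finset.sum_congr rfl fun s _ => sum_jumpSet_map _ _ _ _ _ fun m _ _ => ?_
  fin_cases s
  · change (flag (interleaveBasis _ _) _).map _ = flag (interleaveBasis _ _) _
    rw [flag_interleaveBasis, hprod]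
  · change (flag ((interleaveBasis _ _).map _) _).map _ = flag ((interleaveBasis _ _).map _) _
    rw [flag_map_basis, flag_interleaveBasis, map_prodComm_prod, hprod]
  · change (flag (interleaveBasis _ _) _).map _ = flag (interleaveBasis _ _) _
    rw [flag_interleaveBasis, hprod]

/-- If a doubled triple of spectra is balanced, a generic triple of flags is semistable. -/
theorem degree_nonpos_of_doubled [FiniteDimensional ℝ E] (b : Fin 3 → Module.Basis (Fin p) ℝ E)
    (hb : ∀ V : Submodule ℝ E, ∑ s, (schubertPairs (jumpSet (b s) V)).card
      ≤ Module.finrank ℝ V * (p - Module.finrank ℝ V))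
    {σ : Fin (2 * p) → ℝ} (hσ : Antitone σ) {τ : Fin p → ℝ} (hτ : Antitone τ)
    {Q : Fin 3 → Matrix (Fin (2 * p)) (Fin (2 * p)) ℝ} (hQ : ∀ s, (Q s)ᵀ * Q s = 1)
    (hsum : ∑ s, Q s * diagonal ((![σ, σ, fun j => τ ⟨j.val / 2, by omega⟩] : Fin 3 → _) s)
      * (Q s)ᵀ = 0)
    (V : Submodule ℝ E) :
    degree (fun s => b s) ![fun i => σ (interleave p (Sum.inl i)),
        fun i => σ (interleave p (Sum.inr i)), τ] V ≤ 0 := by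
  have hweights : ∀ s, Antitone ((![σ, σ, fun j => τ ⟨j.val / 2, by omega⟩] : Fin 3 → _) s) := by
    intro s
    fin_cases s
    · exact hσ
    · exact hσ
    · intro i j hij
      exact hτ (Fin.mk_le_mk.mpr (Nat.div_le_div_right hij))
  obtain ⟨W, hmax, hlargest⟩ := exists_largest_maximizer hweights (doubledBasis b)
  have hswap : ∀ x ∈ W, x.swap ∈ W := fun x hx =>
    hlargest _ (degree_doubledBasis_map_prodComm b W σ τ) ⟨x, hx, by simp⟩
  have hneg : ∀ x ∈ W, (x.1, -x.2) ∈ W := fun x hx =>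
    hlargest _ (degree_doubledBasis_map_neg b W _) ⟨x, hx, rfl⟩
  have hfst : ∀ x ∈ W, (x.1, (0 : E)) ∈ W := by
    intro x hx
    have h1 := Submodule.smul_mem W (1 / 2 : ℝ) (Submodule.add_mem W hx (hneg x hx))
    have h2 : (1 / 2 : ℝ) • (x + (x.1, -x.2)) = (x.1, 0) := by
      ext
      · change (1 / 2 : ℝ) • (x.1 + x.1) = x.1
        module
      · simp
    rwa [h2] at h1
  let U := W.comap (LinearMap.inl ℝ E E)
  have hW : W = U.prod U := by
    ext x
    rw [Submodule.mem_prod]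
    constructor
    · exact fun hx => ⟨hfst x hx, hfst _ (hswap x hx)⟩
    · rintro ⟨h1, h2⟩
      have := Submodule.add_mem W h1 (hswap _ h2)
      simpa using this
  have hcount : ∑ s, (schubertPairs (jumpSet (doubledBasis b s) W)).card
      ≤ Module.finrank ℝ W * (2 * p - Module.finrank ℝ W) := by
    have h1 : Module.finrank ℝ W = 2 * Module.finrank ℝ U := by
      rw [hW, ← card_jumpSet (interleaveBasis (b 0) (b 0)), jumpSet_interleaveBasis,
        interleaveFinset, Finset.card_map, Finset.card_disjSum, card_jumpSet, two_mul]
    rw [h1, hW, sum_schubertPairs_doubledBasis, ← Nat.mul_sub]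
    nlinarith [hb U]
  have h1 := degree_nonpos_of_rigid (doubledBasis b) W
    (map_mem_of_largest_maximizer hweights (doubledBasis b) hmax hlargest) hcount hweights hQ hsum
  have h2 := hmax (V.prod V)
  rw [degree_doubledBasis] at h2
  linarith

end Doubling

/-- Finitely many differentiable images of spaces of smaller dimension do not cover a
nonempty open set. -/
lemma exists_mem_open_forall_notMem_range {α : Type*} [Finite α] {F : Type*} [NormedAddCommGroup F]
    [NormedSpace ℝ F] [FiniteDimensional ℝ F] {κ : α → Type*} [∀ a, Fintype (κ a)]
    (f : ∀ a, (κ a → ℝ) → F) (hf : ∀ a, ContDiff ℝ 1 (f a))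
    (hd : ∀ a, Fintype.card (κ a) < Module.finrank ℝ F) {U : Set F} (hU : IsOpen U)
    (hne : U.Nonempty) : ∃ x ∈ U, ∀ a, x ∉ Set.range (f a) := by
  rcases isEmpty_or_nonempty α with h | h
  · obtain ⟨x, hx⟩ := hne
    exact ⟨x, hx, fun a => isEmptyElim a⟩
  have hdim : dimH (⋃ a, Set.range (f a)) < Module.finrank ℝ F := by
    rw [dimH_iUnion]
    obtain ⟨a, ha⟩ := exists_eq_ciSup_of_finite (f := fun a => dimH (Set.range (f a)))
    rw [← ha]
    refine lt_of_le_of_lt ((hf a).dimH_range_le) ?_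
    simpa using hd a
  obtain ⟨x, hxU, hx⟩ := (dense_compl_of_dimH_lt_finrank hdim).inter_open_nonempty U hU hne
  exact ⟨x, hxU, fun a ha => hx (Set.mem_iUnion.mpr ⟨a, ha⟩)⟩

section Incidence

variable {ι : Type*} [Fintype ι] {p : ℕ}

/-- The coordinates of the parametrization of the matrices whose columns are in given position with
respect to a subspace complementary to a coordinate subspace. -/
def incidenceIndices (K : Finset (Fin p)) (I : ι → Finset (Fin p)) :
    Finset ((Fin p × Fin p) ⊕ ((Σ _ : ι, Fin p × Fin p) ⊕ (Σ _ : ι, Fin p × Fin p))) :=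
  (Finset.univ.filter fun q : Fin p × Fin p => q.1 ∉ K ∧ q.2 ∈ K).disjSum
    ((Finset.univ.sigma fun s => Finset.univ.filter fun q : Fin p × Fin p =>
        q.2 ∈ I s → q.1 ∈ K).disjSum
      (Finset.univ.sigma fun s => Finset.univ.filter fun q : Fin p × Fin p =>
        q.1 ∉ I s ∧ q.2 ∈ I s ∧ q.1 < q.2))

lemma card_filter_notMem_mem {n : ℕ} (I K : Finset (Fin n)) :
    (Finset.univ.filter fun q : Fin n × Fin n => q.1 ∉ K ∧ q.2 ∈ I).card
      = (n - K.card) * I.card := by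
  have : (Finset.univ.filter fun q : Fin n × Fin n => q.1 ∉ K ∧ q.2 ∈ I) = Kᶜ ×ˢ I := by
    ext q
    simp
  rw [this, Finset.card_product, Finset.card_compl, Fintype.card_fin]

lemma card_incidenceIndices {r : ℕ} {K : Finset (Fin p)} {I : ι → Finset (Fin p)}
    (hK : K.card = r) (hI : ∀ s, (I s).card = r) :
    (incidenceIndices K I).card + ∑ s, (schubertPairs (I s)).card
      = r * (p - r) + Fintype.card ι * p ^ 2 := by
  rw [incidenceIndices, Finset.card_disjSum, Finset.card_disjSum, Finset.card_sigma,
    Finset.card_sigma, card_filter_notMem_mem, hK, add_assoc, add_assoc,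
    ← Finset.sum_add_distrib, ← Finset.sum_add_distrib, mul_comm, ← smul_eq_mul (Fintype.card ι),
    ← Finset.card_univ, ← Finset.sum_const]
  congr 1
  refine Finset.sum_congr rfl fun s _ => ?_
  have h1 : (Finset.univ.filter fun q : Fin p × Fin p => q.2 ∈ I s → q.1 ∈ K).card
      + (p - r) * r = p ^ 2 := by
    have h := card_filter_notMem_mem (I s) K
    rw [hK, hI s] at h
    rw [← h, show p ^ 2 = (Finset.univ : Finset (Fin p × Fin p)).card by simp [sq],
      ← Finset.card_filter_add_card_filter_not (s := Finset.univ)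
        (fun q : Fin p × Fin p => q.2 ∈ I s → q.1 ∈ K)]
    refine congrArg₂ _ rfl (congrArg Finset.card ?_)
    ext q
    simp only [Finset.mem_filter, Finset.mem_univ, true_and]
    tauto
  have h2 : (Finset.univ.filter fun q : Fin p × Fin p =>
      q.1 ∉ I s ∧ q.2 ∈ I s ∧ q.1 < q.2).card + (schubertPairs (I s)).card = (p - r) * r := by
    have h := card_filter_notMem_mem (I s) (I s)
    rw [hI s] at h
    have hswap : (schubertPairs (I s)).card = (Finset.univ.filter fun q : Fin p × Fin p =>
        q.1 ∉ I s ∧ q.2 ∈ I s ∧ q.2 < q.1).card :=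
      Finset.card_equiv (Equiv.prodComm _ _) fun q => by simp [schubertPairs]; tauto
    rw [← h, hswap, ← Finset.card_filter_add_card_filter_not
      (s := Finset.univ.filter fun q : Fin p × Fin p => q.1 ∉ I s ∧ q.2 ∈ I s)
      (fun q : Fin p × Fin p => q.1 < q.2),
      Finset.filter_filter, Finset.filter_filter]
    refine congrArg₂ _ (congrArg Finset.card ?_) (congrArg Finset.card ?_)
    · ext q
      simp [and_assoc]
    · ext q
      simp only [Finset.mem_filter, Finset.mem_univ, true_and, not_lt, and_assoc]
      refine and_congr_right fun hq1 => and_congr_right fun hq2 => ?_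
      exact ⟨le_of_lt, fun hle => lt_of_le_of_ne hle fun he => hq1 (he ▸ hq2)⟩
  omega

/-- The parametrization of matrices in special position. -/
def incidenceMap (I : ι → Finset (Fin p))
    (y : (Fin p × Fin p) ⊕ ((Σ _ : ι, Fin p × Fin p) ⊕ (Σ _ : ι, Fin p × Fin p)) → ℝ)
    (q : ι × Fin p × Fin p) : ℝ :=
  y (Sum.inr (Sum.inl ⟨q.1, q.2⟩)) + (if q.2.2 ∈ I q.1 then
      ∑ k, y (Sum.inl (q.2.1, k)) * y (Sum.inr (Sum.inl ⟨q.1, (k, q.2.2)⟩)) else 0)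
    + ∑ l, y (Sum.inr (Sum.inr ⟨q.1, (l, q.2.2)⟩)) * y (Sum.inr (Sum.inl ⟨q.1, (q.2.1, l)⟩))

open scoped Classical in
/-- Extension by zero. -/
noncomputable def extendZero {κ : Type*} (S : Finset κ) (y : S → ℝ) (i : κ) : ℝ :=
  if h : i ∈ S then y ⟨i, h⟩ else 0

lemma contDiff_incidenceMap (I : ι → Finset (Fin p)) (S : Finset _) :
    ContDiff ℝ 1 (fun y => incidenceMap I (extendZero S y)) := by
  have h : ∀ i, ContDiff ℝ 1 (fun y : S → ℝ => extendZero S y i) := by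
    intro i
    unfold extendZero
    split_ifs
    · exact contDiff_apply ℝ ℝ _
    · exact contDiff_const
  rw [contDiff_pi]
  intro q
  unfold incidenceMap
  refine ((h _).add ?_).add (ContDiff.sum fun l _ => (h _).mul (h _))
  split_ifs
  · exact ContDiff.sum fun l _ => (h _).mul (h _)
  · exact contDiff_const

lemma exists_extendZero_eq {κ : Type*} (S : Finset κ) (y : κ → ℝ) (hy : ∀ i ∉ S, y i = 0) :
    ∃ x, extendZero S x = y := by
  refine ⟨fun i => y i, ?_⟩
  ext i
  unfold extendZero
  split_ifs with h
  · rfl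
  · exact (hy i h).symm

lemma exists_sum_eq_of_mem_span_image {n : ℕ} {F : Type*} [AddCommGroup F] [Module ℝ F]
    (f : Fin n → F) {S : Set (Fin n)} {x : F} (hx : x ∈ Submodule.span ℝ (f '' S)) :
    ∃ c : Fin n → ℝ, (∀ l ∉ S, c l = 0) ∧ x = ∑ l, c l • f l := by
  obtain ⟨c, hc, rfl⟩ := (Finsupp.mem_span_image_iff_linearCombination ℝ).mp hx
  refine ⟨c, fun l hl => ?_, ?_⟩
  · by_contra hne
    exact hl (hc (Finsupp.mem_support_iff.mpr hne))
  · rw [Finsupp.linearCombination_apply, Finsupp.sum_fintype _ _ fun i => zero_smul ℝ (f i)]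

open scoped Classical in
lemma exists_incidenceMap_eq (g : ι → Fin p → Fin p → ℝ) (V : Submodule ℝ (Fin p → ℝ)) :
    ∃ x, ∀ s j m, g s m j = incidenceMap (fun s => jumpSet (g s) V)
      (extendZero (incidenceIndices (jumpSet (Pi.basisFun ℝ (Fin p)) V)
        (fun s => jumpSet (g s) V)) x) (s, j, m) := by
  obtain ⟨h, -, hV, hred⟩ := exists_adapted_basis (Pi.basisFun ℝ (Fin p)) V
  set K := jumpSet (Pi.basisFun ℝ (Fin p)) V
  have hK : ∀ k ∈ K, ∀ j ∈ K, h k j = if k = j then 1 else 0 := by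
    intro k hk j hj
    have h1 : ∀ w ∈ Submodule.span ℝ (Pi.basisFun ℝ (Fin p) '' {l | l < k ∧ l ∉ K}), w j = 0 := by
      intro w hw
      induction hw using Submodule.span_induction with
      | mem w hw =>
        obtain ⟨l, ⟨-, hl⟩, rfl⟩ := hw
        have hne : l ≠ j := fun he => hl (he ▸ hj)
        simp [hne]
      | zero => rfl
      | add v w _ _ hv hw => simp [hv, hw]
      | smul c v _ hv => simp [hv]
    have h2 := h1 _ (hred k hk)
    rw [Pi.sub_apply, Pi.basisFun_apply, Pi.single_apply, sub_eq_zero] at h2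
    rw [← h2]
    simp [eq_comm]
  have hcoord : ∀ v ∈ V, ∀ j, v j = ∑ k, (if k ∈ K then h k j * v k else 0) := by
    intro v hv j
    rw [hV] at hv
    obtain ⟨c, hc, rfl⟩ := exists_sum_eq_of_mem_span_image _ hv
    rw [Finset.sum_apply]
    refine Finset.sum_congr rfl fun k _ => ?_
    split_ifs with hk
    · rw [Finset.sum_apply, Pi.smul_apply, smul_eq_mul, mul_comm]
      congr 1
      rw [Finset.sum_eq_single k]
      · simp [hK k hk k hk]
      · intro l _ hlk
        by_cases hl : l ∈ K
        · simp [hK l hl k hk, hlk]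
        · simp [hc l hl]
      · simp
    · simp [hc k hk]
  have hz : ∀ s, ∃ (u : Fin p → Fin p → ℝ) (z : Fin p → Fin p → ℝ), ∀ m ∈ jumpSet (g s) V,
      u m ∈ V ∧ (∀ l, ¬ (l < m ∧ l ∉ jumpSet (g s) V) → z m l = 0) ∧
        ∀ j, g s m j = u m j + ∑ l, z m l * g s l j := by
    intro s
    obtain ⟨u, -, hu, hspan⟩ := exists_reduced_adapted (g s) V
    have hex : ∀ m, ∃ z : Fin p → ℝ, m ∈ jumpSet (g s) V →
        (∀ l, ¬ (l < m ∧ l ∉ jumpSet (g s) V) → z l = 0) ∧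
        ∀ j, g s m j = u m j + ∑ l, z l * g s l j := by
      intro m
      by_cases hm : m ∈ jumpSet (g s) V
      · have h1 := hspan m hm
        obtain ⟨c, hc0, hc⟩ := exists_sum_eq_of_mem_span_image _ h1
        refine ⟨c, fun _ => ⟨hc0, fun j => ?_⟩⟩
        have h2 := congrFun hc j
        rw [Finset.sum_apply, Pi.sub_apply, sub_eq_iff_eq_add'] at h2
        simpa using h2
      · exact ⟨0, fun h => absurd h hm⟩
    choose z hz using hex
    exact ⟨u, z, fun m hm => ⟨hu m hm, hz m hm⟩⟩
  choose u z huz using hz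
  obtain ⟨x, hx⟩ := exists_extendZero_eq
    (incidenceIndices K (fun s => jumpSet (g s) V))
    (Sum.elim (fun q => if q.1 ∉ K ∧ q.2 ∈ K then h q.2 q.1 else 0)
      (Sum.elim
        (fun q => if q.2.2 ∈ jumpSet (g q.1) V then if q.2.1 ∈ K then u q.1 q.2.2 q.2.1 else 0
          else g q.1 q.2.2 q.2.1)
        (fun q => if q.2.2 ∈ jumpSet (g q.1) V then z q.1 q.2.2 q.2.1 else 0))) (by
    rintro (q | q | q) hq
    · rw [incidenceIndices, Finset.inl_mem_disjSum] at hq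
      simp only [Finset.mem_filter, Finset.mem_univ, true_and] at hq
      exact if_neg hq
    · simp [incidenceIndices] at hq
      simp [hq]
    · simp only [incidenceIndices, Finset.inr_mem_disjSum, Finset.mem_sigma, Finset.mem_univ,
        true_and, Finset.mem_filter] at hq
      simp only [Sum.elim_inr]
      split_ifs with hm
      · exact (huz q.1 _ hm).2.1 _ (by tauto)
      · rfl)
  refine ⟨x, fun s j m => ?_⟩
  rw [hx]
  simp only [incidenceMap, Sum.elim_inr, Sum.elim_inl]
  by_cases hm : m ∈ jumpSet (g s) V
  · obtain ⟨huV, hz0, hg⟩ := huz s m hm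
    simp only [hm, if_true]
    rw [hg j]
    congr 1
    · rw [hcoord _ huV j]
      by_cases hj : j ∈ K
      · simp only [hj, if_true, not_true_eq_false, false_and, if_false, zero_mul,
          Finset.sum_const_zero, add_zero]
      · simp only [hj, if_false, not_false_eq_true, true_and, zero_add]
        refine Finset.sum_congr rfl fun k _ => ?_
        split_ifs <;> simp
    · refine Finset.sum_congr rfl fun l _ => ?_
      by_cases hl : l < m ∧ l ∉ jumpSet (g s) V
      · simp [hl.2]
      · simp [hz0 l hl]
  · simp [hm]

/-- For a generic family of bases, every subspace is in a position of nonnegative expected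
dimension. -/
theorem exists_generic_bases (ι : Type*) [Fintype ι] (p : ℕ) :
    ∃ b : ι → Module.Basis (Fin p) ℝ (Fin p → ℝ), ∀ V : Submodule ℝ (Fin p → ℝ),
      ∑ s, (schubertPairs (jumpSet (b s) V)).card
        ≤ Module.finrank ℝ V * (p - Module.finrank ℝ V) := by
  let α := {a : Finset (Fin p) × (ι → Finset (Fin p)) //
    (incidenceIndices a.1 a.2).card < Fintype.card ι * p ^ 2}
  let M : (ι × Fin p × Fin p → ℝ) → ι → Matrix (Fin p) (Fin p) ℝ :=
    fun g s => Matrix.of fun j m => g (s, j, m)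
  have hcont : ∀ s, Continuous fun g => (M g s).det := fun s => by
    refine Continuous.matrix_det ?_
    exact continuous_pi fun j => continuous_pi fun m => continuous_apply _
  have hopen : IsOpen {g | ∀ s, (M g s).det ≠ 0} := by
    simp only [Set.ofPred_forall]
    exact isOpen_iInter_of_finite fun s => isOpen_ne_fun (hcont s) continuous_const
  have hne : {g | ∀ s, (M g s).det ≠ 0}.Nonempty := by
    refine ⟨fun q => (1 : Matrix (Fin p) (Fin p) ℝ) q.2.1 q.2.2, fun s => ?_⟩
    have : M (fun q => (1 : Matrix (Fin p) (Fin p) ℝ) q.2.1 q.2.2) s = 1 := rfl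
    rw [this, det_one]
    exact one_ne_zero
  obtain ⟨g, hg, hgen⟩ := exists_mem_open_forall_notMem_range
    (κ := fun a : α => incidenceIndices a.1.1 a.1.2)
    (fun a y => incidenceMap a.1.2 (extendZero (incidenceIndices a.1.1 a.1.2) y))
    (fun a => contDiff_incidenceMap _ _) (fun a => by
      rw [Fintype.card_coe, Module.finrank_fintype_fun_eq_card]
      simpa [sq] using a.2) hopen hne
  have hunit : ∀ s, IsUnit (M g s)ᵀ := fun s => by
    rw [isUnit_iff_isUnit_det, det_transpose]
    exact isUnit_iff_ne_zero.mpr (hg s)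
  let b : ι → Module.Basis (Fin p) ℝ (Fin p → ℝ) := fun s =>
    Module.Basis.mk (linearIndependent_rows_iff_isUnit.mpr (hunit s))
      (LinearIndependent.span_eq_top_of_card_eq_finrank'
        (linearIndependent_rows_iff_isUnit.mpr (hunit s)) (by simp)).ge
  have hb : ∀ s m j, b s m j = g (s, j, m) := fun s m j => by
    simp [b, M]
  refine ⟨b, fun V => ?_⟩
  by_contra hlt
  have hcard := card_incidenceIndices (card_jumpSet (Pi.basisFun ℝ (Fin p)) V)
    (fun s => card_jumpSet (b s) V)
  obtain ⟨x, hx⟩ := exists_incidenceMap_eq (fun s => b s) V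
  refine hgen ⟨⟨jumpSet (Pi.basisFun ℝ (Fin p)) V, fun s => jumpSet (b s) V⟩, ?_⟩ ⟨x, ?_⟩
  · simp only
    omega
  · ext ⟨s, j, m⟩
    rw [← hb]
    exact (hx s j m).symm

end Incidence

section Spectral

variable {α : Type*} [Fintype α] [DecidableEq α]

lemma exists_orthogonal_diagonalization {H : Matrix α α ℝ} (hH : H.IsSymm) :
    ∃ (Q : Matrix α α ℝ) (μ : α → ℝ), Qᵀ * Q = 1 ∧ H = Q * diagonal μ * Qᵀ := by
  have hH' : H.IsHermitian := by
    rw [Matrix.IsHermitian, conjTranspose_eq_transpose_of_trivial]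
    exact hH
  refine ⟨hH'.eigenvectorUnitary, hH'.eigenvalues, ?_, ?_⟩
  · have := Unitary.coe_star_mul_self hH'.eigenvectorUnitary
    rwa [star_eq_conjTranspose, conjTranspose_eq_transpose_of_trivial] at this
  · have := hH'.spectral_theorem
    rw [Unitary.conjStarAlgAut_apply, star_eq_conjTranspose,
      conjTranspose_eq_transpose_of_trivial] at this
    exact this

lemma orthogonal_submatrix {Q : Matrix α α ℝ} (hQ : Qᵀ * Q = 1) (e : Equiv.Perm α) :
    (Q.submatrix id e)ᵀ * Q.submatrix id e = 1 := by
  rw [transpose_submatrix, ← submatrix_mul _ _ _ _ _ Function.bijective_id, hQ]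
  exact submatrix_one_equiv e

lemma conj_diagonal_submatrix (Q : Matrix α α ℝ) (μ : α → ℝ) (e : Equiv.Perm α) :
    Q.submatrix id e * diagonal (μ ∘ e) * (Q.submatrix id e)ᵀ = Q * diagonal μ * Qᵀ := by
  rw [← submatrix_diagonal_equiv, transpose_submatrix, submatrix_mul_equiv,
    submatrix_mul_equiv, submatrix_id_id]

lemma exists_orthogonal_diagonalization_antitone {n : ℕ} {H : Matrix (Fin n) (Fin n) ℝ}
    (hH : H.IsSymm) : ∃ (Q : Matrix (Fin n) (Fin n) ℝ) (μ : Fin n → ℝ),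
      Qᵀ * Q = 1 ∧ Antitone μ ∧ H = Q * diagonal μ * Qᵀ := by
  obtain ⟨Q, μ, hQ, h⟩ := exists_orthogonal_diagonalization hH
  obtain ⟨e, he⟩ : ∃ e : Equiv.Perm (Fin n), Antitone (μ ∘ e) := by
    refine ⟨Tuple.sort (fun i => - μ i), fun i j hij => ?_⟩
    have := Tuple.monotone_sort (fun i => - μ i) hij
    simpa using this
  exact ⟨Q.submatrix id e, μ ∘ e, orthogonal_submatrix hQ e, he,
    h.trans (conj_diagonal_submatrix Q μ e).symm⟩

lemma det_sq_of_orthogonal {Q : Matrix α α ℝ} (hQ : Qᵀ * Q = 1) : Q.det ^ 2 = 1 := by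
  have := congrArg det hQ
  rwa [det_mul, det_transpose, det_one, ← sq] at this

lemma charpoly_orthogonal_conj {Q : Matrix α α ℝ} (hQ : Qᵀ * Q = 1) (μ : α → ℝ) :
    (Q * diagonal μ * Qᵀ).charpoly = ∏ i, (Polynomial.X - Polynomial.C (μ i)) := by
  rw [charpoly_mul_comm, ← Matrix.mul_assoc, hQ, Matrix.one_mul, charpoly_diagonal]

lemma one_le_det_one_add {B : Matrix α α ℝ} (hB : B.PosSemidef) : 1 ≤ (1 + B).det := by
  have hB' : B.IsSymm := by
    have := hB.1
    rwa [Matrix.IsHermitian, conjTranspose_eq_transpose_of_trivial] at this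
  obtain ⟨Q, μ, hQ, h⟩ := exists_orthogonal_diagonalization hB'
  have hQ' : Q * Qᵀ = 1 := mul_eq_one_comm.mp hQ
  have hμ : ∀ i, 0 ≤ μ i := by
    rw [← posSemidef_diagonal_iff]
    have h2 : diagonal μ = Qᴴ * B * Q := by
      rw [h, conjTranspose_eq_transpose_of_trivial]
      simp only [Matrix.mul_assoc, hQ]
      rw [← Matrix.mul_assoc, hQ, Matrix.one_mul, Matrix.mul_one]
    rw [h2]
    exact hB.conjTranspose_mul_mul_same Q
  have : 1 + B = Q * diagonal (fun i => 1 + μ i) * Qᵀ := by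
    have : diagonal (fun i => 1 + μ i) = 1 + diagonal μ := by
      rw [← diagonal_one, diagonal_add]
    rw [this, Matrix.mul_add, Matrix.add_mul, Matrix.mul_one, hQ', h]
  rw [this, det_mul, det_mul, det_transpose, det_diagonal]
  have h1 := det_sq_of_orthogonal hQ
  have h2 : 1 ≤ ∏ i, (1 + μ i) :=
    Finset.one_le_prod fun i _ => by linarith [hμ i]
  nlinarith

lemma det_le_det_add {K B : Matrix α α ℝ} (hK : K.det ≠ 0) (hB : B.PosSemidef) :
    (Kᵀ * K).det ≤ (Kᵀ * K + B).det := by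
  have hu : IsUnit K.det := hK.isUnit
  have h1 : K⁻¹ * K = 1 := nonsing_inv_mul K hu
  have h2 : Kᵀ * (K⁻¹)ᵀ = 1 := by rw [← transpose_mul, h1, transpose_one]
  have h3 : Kᵀ * K + B = Kᵀ * (1 + (K⁻¹)ᵀ * B * K⁻¹) * K := by
    rw [Matrix.mul_add, Matrix.add_mul, Matrix.mul_one]
    congr 1
    calc B = (Kᵀ * (K⁻¹)ᵀ) * B * (K⁻¹ * K) := by rw [h1, h2, Matrix.one_mul, Matrix.mul_one]
      _ = _ := by simp only [Matrix.mul_assoc]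
  have h4 : ((K⁻¹)ᵀ * B * K⁻¹).PosSemidef := by
    rw [← conjTranspose_eq_transpose_of_trivial]
    exact hB.conjTranspose_mul_mul_same _
  have h5 := one_le_det_one_add h4
  rw [h3, det_mul, det_mul, det_mul, det_transpose]
  nlinarith [mul_self_nonneg K.det]

lemma log_det_le_trace_sub_card {N : Matrix α α ℝ} (hN : N.PosDef) :
    Real.log N.det ≤ N.trace - Fintype.card α := by
  rw [hN.1.det_eq_prod_eigenvalues, hN.1.trace_eq_sum_eigenvalues]
  simp only [RCLike.ofReal_real_eq_id, id_eq]
  rw [Real.log_prod fun i _ => (hN.eigenvalues_pos i).ne']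
  calc ∑ i, Real.log (hN.1.eigenvalues i) ≤ ∑ i, (hN.1.eigenvalues i - 1) :=
        Finset.sum_le_sum fun i _ => Real.log_le_sub_one_of_pos (hN.eigenvalues_pos i)
    _ = _ := by simp [Finset.sum_sub_distrib]

lemma prod_mul_det_minor_sq_le {β : Type*} [Fintype β] [DecidableEq β] (R : Matrix α β ℝ)
    {e : β → α} (he : Function.Injective e) {μ : α → ℝ} (hμ : ∀ i, 0 < μ i)
    (hR : (R.submatrix e id).det ≠ 0) :
    (∏ i, μ (e i)) * (R.submatrix e id).det ^ 2 ≤ (Rᵀ * diagonal μ * R).det := by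
  classical
  set K : Matrix β β ℝ := diagonal (fun i => √(μ (e i))) * R.submatrix e id with hK
  set B : Matrix β β ℝ :=
    Rᵀ * diagonal (fun i => if i ∈ Set.range e then 0 else μ i) * R with hB
  have h1 : Rᵀ * diagonal μ * R = Kᵀ * K + B := by
    ext a b
    have h2 : (Kᵀ * K) a b = ∑ j, R (e j) a * μ (e j) * R (e j) b := by
      rw [Matrix.mul_apply]
      refine Finset.sum_congr rfl fun j _ => ?_
      have := Real.mul_self_sqrt (hμ (e j)).le
      simp only [hK, transpose_apply, diagonal_mul, submatrix_apply, id_eq]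
      linear_combination (R (e j) a * R (e j) b) * this
    have h3 : ∑ j, R (e j) a * μ (e j) * R (e j) b =
        ∑ i ∈ Finset.univ.filter (· ∈ Set.range e), R i a * μ i * R i b := by
      rw [show Finset.univ.filter (· ∈ Set.range e) = Finset.univ.image e by ext; simp,
        Finset.sum_image he.injOn]
    rw [Matrix.add_apply, h2, h3, Finset.sum_filter, hB, Matrix.mul_apply, Matrix.mul_apply,
      ← Finset.sum_add_distrib]
    refine Finset.sum_congr rfl fun i _ => ?_
    simp only [mul_diagonal, transpose_apply]
    split_ifs <;> simp
  have hdet : K.det ^ 2 = (∏ i, μ (e i)) * (R.submatrix e id).det ^ 2 := by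
    rw [hK, det_mul, det_diagonal, mul_pow, ← Finset.prod_pow]
    congr 1
    exact Finset.prod_congr rfl fun i _ => Real.sq_sqrt (hμ _).le
  have hpos : 0 < ∏ i, μ (e i) := Finset.prod_pos fun i _ => hμ _
  have hK0 : K.det ≠ 0 := by
    intro h
    rw [h] at hdet
    exact (mul_pos hpos (sq_pos_of_ne_zero hR)).ne (by simpa using hdet)
  have hBp : B.PosSemidef := by
    rw [hB, ← conjTranspose_eq_transpose_of_trivial]
    refine PosSemidef.conjTranspose_mul_mul_same ?_ R
    rw [posSemidef_diagonal_iff]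
    intro i
    split_ifs
    · exact le_rfl
    · exact (hμ i).le
  have hdet' : K.det ^ 2 = (Kᵀ * K).det := by rw [det_mul Kᵀ, det_transpose, sq]
  rw [← hdet, h1, hdet']
  exact det_le_det_add hK0 hBp

end Spectral

lemma finrank_flag {n : ℕ} {E : Type*} [AddCommGroup E] [Module ℝ E]
    (b : Module.Basis (Fin n) ℝ E) {m : ℕ} (hm : m ≤ n) :
    Module.finrank ℝ (flag b m) = m := by
  have h := finrank_inf_flag b ⊤ hm
  rw [top_inf_eq] at h
  have h2 : jumpSet b ⊤ = Finset.univ := by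
    ext i
    simp only [mem_jumpSet, Finset.mem_univ, iff_true]
    exact ⟨b i, trivial, by simp⟩
  rw [h, h2]
  have : (Finset.univ.filter fun i : Fin n => i.val < m) = (Finset.univ : Finset (Fin m)).map
      (Fin.castLEEmb hm) := by
    ext i
    simp only [Finset.mem_filter, Finset.mem_univ, true_and, Finset.mem_map]
    exact ⟨fun h => ⟨⟨i, h⟩, rfl⟩, by rintro ⟨j, rfl⟩; exact j.2⟩
  rw [this, Finset.card_map, Finset.card_univ, Fintype.card_fin]

lemma exists_mem_jumpSet_repr_ne_zero {n : ℕ} {E : Type*} [AddCommGroup E] [Module ℝ E]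
    (b : Module.Basis (Fin n) ℝ E) {V : Submodule ℝ E} {x : E} (hx : x ∈ V) (h0 : x ≠ 0) :
    ∃ i ∈ jumpSet b V, b.repr x i ≠ 0 := by
  have hne : (Finset.univ.filter fun i => b.repr x i ≠ 0).Nonempty := by
    by_contra h
    rw [Finset.not_nonempty_iff_eq_empty, Finset.filter_eq_empty_iff] at h
    refine h0 (b.repr.map_eq_zero_iff.mp (Finsupp.ext fun i => ?_))
    simpa using h (Finset.mem_univ i)
  obtain ⟨i, hi, hmax⟩ := Finset.exists_max_image _ id hne
  have hi' : b.repr x i ≠ 0 := (Finset.mem_filter.mp hi).2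
  refine ⟨i, mem_jumpSet.mpr ⟨(b.repr x i)⁻¹ • x, V.smul_mem _ hx, ?_⟩, hi'⟩
  rw [mem_flag_iff b]
  intro j hj
  simp only [map_sub, map_smul, Module.Basis.repr_self, Finsupp.sub_apply, Finsupp.smul_apply,
    smul_eq_mul]
  rcases eq_or_ne j i with rfl | hji
  · simp [hi']
  · have : b.repr x j = 0 := by
      by_contra hj'
      have h1 : j ≤ i := hmax j (Finset.mem_filter.mpr ⟨Finset.mem_univ _, hj'⟩)
      exact hji (le_antisymm h1 hj)
    simp [this, hji.symm]

lemma card_subtype_le {n : ℕ} (m : Fin n) : Fintype.card {i : Fin n // i ≤ m} = m.val + 1 := by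
  rw [Fintype.card_subtype, ← Fin.card_Iic m]
  congr 1
  ext i
  simp

lemma exists_nonzero_minor {n : ℕ} (g c : Module.Basis (Fin n) ℝ (Fin n → ℝ))
    {O : Matrix (Fin n) (Fin n) ℝ} (hc : ∀ x i, c.repr x i = (O *ᵥ x) i.rev) (m : Fin n) :
    ∃ e : {i : Fin n // i ≤ m} → Fin n, Function.Injective e ∧
      ((O * Matrix.of fun i j => g j i).submatrix e Subtype.val).det ≠ 0 ∧
      ∀ k ≤ n, ((Finset.univ.image e).filter fun l => l.val < k).card +
        Module.finrank ℝ (flag c (n - k) ⊓ flag g (m.val + 1) : Submodule ℝ (Fin n → ℝ)) =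
          m.val + 1 := by
  set W := flag g (m.val + 1) with hW
  have hWr : Module.finrank ℝ W = m.val + 1 := finrank_flag g m.2
  have hcard : (jumpSet c W).card = m.val + 1 := by rw [card_jumpSet, hWr]
  have hcard' : Fintype.card {i : Fin n // i ≤ m} = Fintype.card (jumpSet c W) := by
    rw [card_subtype_le, Fintype.card_coe, hcard]
  let ε : {i : Fin n // i ≤ m} ≃ jumpSet c W := Fintype.equivOfCardEq hcard'
  have he : Function.Injective fun i => (ε i).1.rev := fun i j h =>
    ε.injective (Subtype.ext (Fin.rev_injective h))
  refine ⟨fun i => (ε i).1.rev, he, ?_, ?_⟩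
  · intro hdet
    obtain ⟨v, hv, hv0⟩ := Matrix.exists_mulVec_eq_zero_iff.mpr hdet
    set x : Fin n → ℝ := ∑ j, v j • g j.1 with hx
    have hxW : x ∈ W := Submodule.sum_mem _ fun j _ => Submodule.smul_mem _ _
      (mem_flag g (Nat.lt_succ_of_le j.2))
    have hx0 : x ≠ 0 := by
      intro h
      have hli : LinearIndependent ℝ fun j : {i : Fin n // i ≤ m} => g j.1 :=
        g.linearIndependent.comp _ Subtype.val_injective
      exact hv (funext (Fintype.linearIndependent_iff.mp hli v h))
    obtain ⟨i, hi, hi0⟩ := exists_mem_jumpSet_repr_ne_zero c hxW hx0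
    apply hi0
    have h1 := congrFun hv0 (ε.symm ⟨i, hi⟩)
    rw [hc, hx, mulVec_sum, Finset.sum_apply]
    simp only [mulVec, dotProduct, submatrix_apply, Equiv.apply_symm_apply, Pi.zero_apply,
      Matrix.mul_apply, Matrix.of_apply] at h1
    rw [← h1]
    refine Finset.sum_congr rfl fun j _ => ?_
    simp only [mulVec, dotProduct, Pi.smul_apply, smul_eq_mul, Finset.sum_mul]
    exact Finset.sum_congr rfl fun l _ => by ring
  · intro k hk
    have h1 : (Finset.univ.image fun i => (ε i).1.rev) =
        (jumpSet c W).map Fin.revPerm.toEmbedding := by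
      ext l
      simp only [Finset.mem_image, Finset.mem_univ, true_and, Finset.mem_map]
      constructor
      · rintro ⟨i, rfl⟩
        exact ⟨(ε i).1, (ε i).2, rfl⟩
      · rintro ⟨i, hi, rfl⟩
        exact ⟨ε.symm ⟨i, hi⟩, by simp⟩
    rw [h1, Finset.filter_map, Finset.card_map, inf_comm, finrank_inf_flag c W (Nat.sub_le n k),
      ← hcard, add_comm]
    rw [← Finset.card_filter_add_card_filter_not (s := jumpSet c W) (fun i => i.val < n - k)]
    congr 2
    ext i
    simp only [Finset.mem_filter, Function.comp, Equiv.coe_toEmbedding, Fin.revPerm_apply,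
      Fin.val_rev, and_congr_right_iff]
    intro _
    omega

lemma card_filter_le_val {n : ℕ} (m : Fin n) :
    ((Finset.univ : Finset (Fin n)).filter fun i => i.val < m.val + 1).card = m.val + 1 := by
  have h : (Finset.univ.filter fun i : Fin n => i.val < m.val + 1) = Finset.Iic m := by
    ext i
    simp only [Finset.mem_filter, Finset.mem_univ, true_and, Finset.mem_Iic, Fin.le_def]
    omega
  rw [h, Fin.card_Iic]

lemma weighted_minor_sum_nonneg {ι : Type*} [Fintype ι] {n : ℕ}
    (b : ι → Module.Basis (Fin n) ℝ (Fin n → ℝ)) (c : Module.Basis (Fin n) ℝ (Fin n → ℝ))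
    {σ w : ι → Fin n → ℝ} (hw : ∀ s i, σ s i = ∑ m : Fin n, if i ≤ m then w s m else 0)
    (hsum : ∑ s, ∑ i, σ s i = 0) (hss : ∀ V, degree (fun s => b s) σ V ≤ 0)
    {e : ι → (m : Fin n) → {i : Fin n // i ≤ m} → Fin n}
    (he : ∀ s m, Function.Injective (e s m))
    (hcount : ∀ s m, ∀ k ≤ n, ((Finset.univ.image (e s m)).filter fun l => l.val < k).card +
        Module.finrank ℝ (flag c (n - k) ⊓ flag (b s) (m.val + 1) : Submodule ℝ (Fin n → ℝ)) =
          m.val + 1)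
    {μ : Fin n → ℝ} (hμ : Antitone μ) :
    0 ≤ ∑ s, ∑ m, w s m * ∑ i, μ (e s m i) := by
  obtain ⟨v, hv, hv'⟩ := exists_weights μ
  have h1 : ∀ s m, ∑ i, μ (e s m i) = ∑ k : Fin n, v k * ((m.val + 1 : ℝ) -
      Module.finrank ℝ
        (flag c (n - (k.val + 1)) ⊓ flag (b s) (m.val + 1) : Submodule ℝ (Fin n → ℝ))) := by
    intro s m
    rw [← Finset.sum_image (s := Finset.univ) (g := e s m) (he s m).injOn,
      sum_eq_sum_weights hv']
    refine Finset.sum_congr rfl fun k _ => ?_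
    have := hcount s m (k.val + 1) k.2
    congr 1
    rw [eq_sub_iff_add_eq]
    exact_mod_cast this
  have h2 : ∑ s, ∑ m, w s m * ∑ i, μ (e s m i) =
      ∑ k : Fin n, v k * (- degree (fun s => b s) σ (flag c (n - (k.val + 1)))) := by
    have h3 : ∀ s, ∑ m : Fin n, w s m * (m.val + 1 : ℝ) = ∑ i, σ s i := by
      intro s
      rw [sum_eq_sum_weights (hw s)]
      refine Finset.sum_congr rfl fun m _ => ?_
      rw [card_filter_le_val]
      push_cast
      rfl
    have h4 : ∀ k : Fin n, - degree (fun s => b s) σ (flag c (n - (k.val + 1))) =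
        ∑ s, ∑ m, w s m * ((m.val + 1 : ℝ) - Module.finrank ℝ
          (flag c (n - (k.val + 1)) ⊓ flag (b s) (m.val + 1) : Submodule ℝ (Fin n → ℝ))) := by
      intro k
      simp_rw [mul_sub, Finset.sum_sub_distrib, h3]
      rw [hsum, zero_sub, degree]
      congr 1
      exact Finset.sum_congr rfl fun s _ => sum_jumpSet (hw s) (b s) _
    simp_rw [h4, h1, Finset.mul_sum]
    rw [Finset.sum_comm (s := (Finset.univ : Finset (Fin n)))]
    refine Finset.sum_congr rfl fun s _ => ?_
    rw [Finset.sum_comm]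
    exact Finset.sum_congr rfl fun k _ => Finset.sum_congr rfl fun m _ => by ring
  rw [h2]
  refine Finset.sum_nonneg fun k _ => ?_
  by_cases hk : k.val + 1 < n
  · refine mul_nonneg ?_ (neg_nonneg.mpr (hss _))
    rw [hv k hk]
    exact sub_nonneg.mpr (hμ (Fin.le_def.mpr (by simp)))
  · have h5 : n - (k.val + 1) = 0 := by omega
    have h6 : degree (fun s => b s) σ (⊥ : Submodule ℝ (Fin n → ℝ)) = 0 := by
      refine Finset.sum_eq_zero fun s _ => ?_
      change ∑ i ∈ _, σ s i = 0
      rw [sum_jumpSet (hw s)]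
      exact Finset.sum_eq_zero fun m _ => by rw [bot_inf_eq, finrank_bot, Nat.cast_zero, mul_zero]
    rw [h5, flag_zero, h6, neg_zero, mul_zero]

/-- The leading principal submatrix with indices at most `m`. -/
def leading {n : ℕ} (m : Fin n) (N : Matrix (Fin n) (Fin n) ℝ) :
    Matrix {i : Fin n // i ≤ m} {i : Fin n // i ≤ m} ℝ :=
  N.submatrix Subtype.val Subtype.val

/-- A weighted sum of the logarithms of the leading principal minors. -/
noncomputable def logMinorSum {ι : Type*} [Fintype ι] {n : ℕ} (w : ι → Fin n → ℝ)
    (N : ι → Matrix (Fin n) (Fin n) ℝ) : ℝ :=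
  ∑ s, ∑ m, w s m * Real.log (leading m (N s)).det

lemma det_leading_last {n : ℕ} {m : Fin n} (hm : ¬ m.val + 1 < n)
    (N : Matrix (Fin n) (Fin n) ℝ) : (leading m N).det = N.det := by
  have h : ∀ i : Fin n, i ≤ m := fun i => Fin.le_def.mpr (by omega)
  exact det_submatrix_equiv_self (Equiv.subtypeUnivEquiv h) N

lemma isCompact_orthogonal (n : ℕ) :
    IsCompact {Q : Matrix (Fin n) (Fin n) ℝ | Qᵀ * Q = 1} := by
  have h1 : IsCompact (Set.univ.pi fun _ : Fin n => Set.univ.pi fun _ : Fin n =>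
      Set.Icc (-1 : ℝ) 1) :=
    isCompact_univ_pi fun _ => isCompact_univ_pi fun _ => isCompact_Icc
  refine IsCompact.of_isClosed_subset h1 ?_ ?_
  · exact isClosed_eq (by fun_prop) continuous_const
  · intro Q hQ i _ j _
    have h2 := congrFun (congrFun (show Qᵀ * Q = 1 from hQ) j) j
    rw [Matrix.mul_apply, one_apply_eq] at h2
    have h3 : Q i j ^ 2 ≤ 1 := by
      rw [← h2, sq]
      exact Finset.single_le_sum (f := fun k => Qᵀ j k * Q k j)
        (fun k _ => mul_self_nonneg (Q k j)) (Finset.mem_univ i)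
    exact abs_le.mp ((sq_le_one_iff_abs_le_one _).mp h3)

lemma leading_conj {n : ℕ} (m : Fin n) (H : Matrix (Fin n) (Fin n) ℝ) (μ : Fin n → ℝ) :
    leading m (Hᵀ * diagonal μ * H) =
      (H.submatrix id Subtype.val)ᵀ * diagonal μ * H.submatrix id Subtype.val := by
  ext i j
  simp [leading, Matrix.mul_apply]

lemma log_det_leading_ge {n : ℕ} {m : Fin n} (H : Matrix (Fin n) (Fin n) ℝ)
    {e : {i : Fin n // i ≤ m} → Fin n} (he : Function.Injective e) {μ : Fin n → ℝ}
    (hμ : ∀ i, 0 < μ i) {δ : ℝ} (hδ : 0 < δ)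
    (hH : δ < (H.submatrix e Subtype.val).det ^ 2) :
    ∑ i, Real.log (μ (e i)) + Real.log δ ≤
      Real.log (leading m (Hᵀ * diagonal μ * H)).det := by
  have h0 : ((H.submatrix id Subtype.val).submatrix e id).det ≠ 0 := by
    intro h
    rw [submatrix_submatrix, Function.comp_id, Function.id_comp] at h
    rw [h] at hH
    norm_num at hH
    linarith
  have h1 := prod_mul_det_minor_sq_le _ he hμ h0
  rw [submatrix_submatrix, Function.comp_id, Function.id_comp] at h1
  have h2 : 0 < ∏ i, μ (e i) := Finset.prod_pos fun i _ => hμ _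
  rw [leading_conj, ← Real.log_prod fun i _ => (hμ (e i)).ne', ← Real.log_mul h2.ne' hδ.ne']
  exact Real.log_le_log (mul_pos h2 hδ)
    ((mul_le_mul_of_nonneg_left hH.le h2.le).trans h1)

lemma log_det_leading_last {n : ℕ} {m : Fin n} (hm : ¬ m.val + 1 < n)
    {O G : Matrix (Fin n) (Fin n) ℝ} (hO : Oᵀ * O = 1) (hG : G.det ≠ 0)
    {e : {i : Fin n // i ≤ m} → Fin n} (he : Function.Injective e) {μ : Fin n → ℝ}
    (hμ : ∀ i, 0 < μ i) :
    Real.log (leading m ((O * G)ᵀ * diagonal μ * (O * G))).det =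
      ∑ i, Real.log (μ (e i)) + Real.log (G.det ^ 2) := by
  have hcard : Fintype.card {i : Fin n // i ≤ m} = Fintype.card (Fin n) := by
    rw [card_subtype_le, Fintype.card_fin]
    omega
  have hb : Function.Bijective e := (Fintype.bijective_iff_injective_and_card e).mpr ⟨he, hcard⟩
  have h1 : ∑ i, Real.log (μ (e i)) = ∑ i, Real.log (μ i) :=
    Fintype.sum_bijective e hb _ _ fun _ => rfl
  have h2 : ((O * G)ᵀ * diagonal μ * (O * G)).det = (∏ i, μ i) * G.det ^ 2 := by
    have := det_sq_of_orthogonal hO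
    simp only [det_mul, det_transpose, det_diagonal]
    linear_combination (∏ i, μ i) * G.det ^ 2 * this
  rw [det_leading_last hm, h2, h1, ← Real.log_prod fun i _ => (hμ i).ne',
    Real.log_mul (Finset.prod_pos fun i _ => hμ i).ne' (pow_ne_zero 2 hG)]

lemma exists_basis_repr_eq_rev {n : ℕ} {O : Matrix (Fin n) (Fin n) ℝ} (hO : Oᵀ * O = 1) :
    ∃ c : Module.Basis (Fin n) ℝ (Fin n → ℝ), ∀ x i, c.repr x i = (O *ᵥ x) i.rev := by
  let L : (Fin n → ℝ) ≃ₗ[ℝ] (Fin n → ℝ) :=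
    Matrix.toLin'OfInv hO (mul_eq_one_comm.mp hO)
  refine ⟨Module.Basis.ofEquivFun (L.trans (LinearEquiv.funCongrLeft ℝ ℝ Fin.revPerm)),
    fun x i => ?_⟩
  rfl

lemma exists_lower_bound_logMinorSum {ι : Type*} [Fintype ι] {n : ℕ}
    (b : ι → Module.Basis (Fin n) ℝ (Fin n → ℝ)) {σ w : ι → Fin n → ℝ}
    (hw : ∀ s i, σ s i = ∑ m : Fin n, if i ≤ m then w s m else 0)
    (hw0 : ∀ s m, m.val + 1 < n → 0 ≤ w s m)
    (hsum : ∑ s, ∑ i, σ s i = 0) (hss : ∀ V, degree (fun s => b s) σ V ≤ 0)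
    {G : ι → Matrix (Fin n) (Fin n) ℝ} (hG : ∀ s, G s = Matrix.of fun i j => b s j i)
    (hG0 : ∀ s, (G s).det ≠ 0) :
    ∃ C : ℝ, ∀ (O : Matrix (Fin n) (Fin n) ℝ) (μ : Fin n → ℝ), Oᵀ * O = 1 → Antitone μ →
      (∀ i, 0 < μ i) →
        C ≤ logMinorSum w fun s => (O * G s)ᵀ * diagonal μ * (O * G s) := by
  suffices h : ∃ C : ℝ, ∀ O ∈ {Q : Matrix (Fin n) (Fin n) ℝ | Qᵀ * Q = 1}, Oᵀ * O = 1 →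
      ∀ μ : Fin n → ℝ, Antitone μ → (∀ i, 0 < μ i) →
        C ≤ logMinorSum w fun s => (O * G s)ᵀ * diagonal μ * (O * G s) by
    obtain ⟨C, hC⟩ := h
    exact ⟨C, fun O μ hO => hC O hO hO μ⟩
  refine (isCompact_orthogonal n).induction_on (p := fun S => ∃ C : ℝ, ∀ O ∈ S, Oᵀ * O = 1 →
      ∀ μ : Fin n → ℝ, Antitone μ → (∀ i, 0 < μ i) →
        C ≤ logMinorSum w fun s => (O * G s)ᵀ * diagonal μ * (O * G s)) ?_ ?_ ?_ ?_
  · exact ⟨0, by rintro O ⟨⟩⟩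
  · rintro S T hST ⟨C, hC⟩
    exact ⟨C, fun O hO => hC O (hST hO)⟩
  · rintro S T ⟨C, hC⟩ ⟨D, hD⟩
    refine ⟨min C D, ?_⟩
    rintro O (hO | hO) h1 μ h2 h3
    · exact (min_le_left _ _).trans (hC O hO h1 μ h2 h3)
    · exact (min_le_right _ _).trans (hD O hO h1 μ h2 h3)
  · intro O hO
    obtain ⟨c, hc⟩ := exists_basis_repr_eq_rev hO
    choose e he hdet hcount using fun s m => exists_nonzero_minor (b s) c hc m
    set δ : ι → Fin n → ℝ :=
      fun s m => ((O * G s).submatrix (e s m) Subtype.val).det ^ 2 / 2 with hδ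
    have hδ0 : ∀ s m, 0 < δ s m := fun s m => by
      have := hdet s m
      rw [← hG] at this
      exact half_pos (sq_pos_of_ne_zero this)
    have hev : ∀ᶠ O' in nhds O, ∀ s m,
        δ s m < ((O' * G s).submatrix (e s m) Subtype.val).det ^ 2 := by
      rw [Filter.eventually_all]
      intro s
      rw [Filter.eventually_all]
      intro m
      have hcont : Continuous fun O' : Matrix (Fin n) (Fin n) ℝ =>
          ((O' * G s).submatrix (e s m) Subtype.val).det ^ 2 := by
        refine Continuous.pow (Continuous.matrix_det ?_) 2
        exact Continuous.matrix_submatrix (by fun_prop) _ _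
      exact hcont.continuousAt.eventually (lt_mem_nhds (half_lt_self
        (by have := hδ0 s m; simp only [hδ] at this; linarith)))
    refine ⟨_, mem_nhdsWithin_of_mem_nhds hev, ∑ s, ∑ m, w s m *
      (if m.val + 1 < n then Real.log (δ s m) else Real.log ((G s).det ^ 2)), ?_⟩
    intro O' hO' hO'o μ hμ hμ0
    have hnn := weighted_minor_sum_nonneg b c hw hsum hss he hcount
      (μ := fun i => Real.log (μ i)) fun i j hij => Real.log_le_log (hμ0 j) (hμ hij)
    refine le_trans (le_add_of_nonneg_left hnn) ?_
    rw [logMinorSum, ← Finset.sum_add_distrib]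
    refine Finset.sum_le_sum fun s _ => ?_
    rw [← Finset.sum_add_distrib]
    refine Finset.sum_le_sum fun m _ => ?_
    rw [← mul_add]
    split_ifs with hm
    · exact mul_le_mul_of_nonneg_left
        (log_det_leading_ge _ (he s m) hμ0 (hδ0 s m) (hO' s m)) (hw0 s m hm)
    · rw [log_det_leading_last hm hO'o (hG0 s) (he s m) hμ0]

lemma exists_orthogonal_mul_upper {n : ℕ} (A : Matrix (Fin n) (Fin n) ℝ) :
    ∃ Q U : Matrix (Fin n) (Fin n) ℝ, Qᵀ * Q = 1 ∧ A = Q * U ∧ ∀ i j, j < i → U i j = 0 := by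
  let f : Fin n → EuclideanSpace ℝ (Fin n) := fun j => WithLp.toLp 2 fun i => A i j
  have hfin : Module.finrank ℝ (EuclideanSpace ℝ (Fin n)) = Fintype.card (Fin n) := by simp
  let q := InnerProductSpace.gramSchmidtOrthonormalBasis hfin f
  let Q : Matrix (Fin n) (Fin n) ℝ := Matrix.of fun i j => q j i
  have hQ : Qᵀ * Q = 1 := by
    ext i j
    have h := orthonormal_iff_ite.mp q.orthonormal i j
    rw [PiLp.inner_apply] at h
    rw [Matrix.mul_apply, one_apply, ← h]
    refine Finset.sum_congr rfl fun l _ => ?_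
    simp [Q, mul_comm]
  refine ⟨Q, Qᵀ * A, hQ, ?_, fun i j hij => ?_⟩
  · rw [← Matrix.mul_assoc, mul_eq_one_comm.mp hQ, Matrix.one_mul]
  · have h := InnerProductSpace.gramSchmidtOrthonormalBasis_inv_triangular hfin f hij
    rw [PiLp.inner_apply] at h
    rw [Matrix.mul_apply, ← h]
    refine Finset.sum_congr rfl fun l _ => ?_
    simp [Q, f, q, mul_comm]

lemma leading_upper_conj {n : ℕ} (m : Fin n) {U : Matrix (Fin n) (Fin n) ℝ}
    (hU : ∀ i j, j < i → U i j = 0) (N : Matrix (Fin n) (Fin n) ℝ) :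
    leading m (Uᵀ * N * U) = (leading m U)ᵀ * leading m N * leading m U := by
  have h1 : ∀ A : Matrix (Fin n) (Fin n) ℝ,
      leading m (A * U) = leading m A * leading m U := by
    intro A
    ext i j
    simp only [leading, submatrix_apply, Matrix.mul_apply]
    rw [← Fintype.sum_subtype_add_sum_subtype (fun l => l ≤ m)]
    rw [add_eq_left]
    exact Finset.sum_eq_zero fun l _ => by
      rw [hU l.1 j.1 (lt_of_le_of_lt j.2 (not_le.mp l.2)), mul_zero]
  have h2 : ∀ A : Matrix (Fin n) (Fin n) ℝ, leading m Aᵀ = (leading m A)ᵀ := fun A => rfl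
  have h3 : leading m (Uᵀ * N) = (leading m U)ᵀ * leading m N := by
    have := congrArg transpose (h1 Nᵀ)
    rw [← h2, transpose_mul, transpose_transpose, transpose_mul, h2 N, transpose_transpose] at this
    exact this
  rw [h1, h3]

lemma det_leading_upper_ne_zero {n : ℕ} (m : Fin n) {U : Matrix (Fin n) (Fin n) ℝ}
    (hU : ∀ i j, j < i → U i j = 0) (h0 : U.det ≠ 0) : (leading m U).det ≠ 0 := by
  have h1 : U.BlockTriangular id := fun i j hij => hU i j hij
  have h2 : (leading m U).BlockTriangular id := fun i j hij => hU i.1 j.1 hij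
  rw [det_of_isUpperTriangular h1, Finset.prod_ne_zero_iff] at h0
  rw [det_of_isUpperTriangular h2, Finset.prod_ne_zero_iff]
  exact fun i _ => h0 i.1 (Finset.mem_univ _)

lemma posDef_leading {n : ℕ} (m : Fin n) {H : Matrix (Fin n) (Fin n) ℝ} (hH : H.det ≠ 0) :
    (leading m (Hᵀ * H)).PosDef := by
  refine PosDef.submatrix ?_ Subtype.val_injective
  rw [← conjTranspose_eq_transpose_of_trivial]
  refine PosDef.conjTranspose_mul_self _ ?_
  exact mulVec_injective_iff_isUnit.mpr ((isUnit_iff_isUnit_det _).mpr hH.isUnit)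

lemma logMinorSum_upper_conj {ι : Type*} [Fintype ι] {n : ℕ} (w : ι → Fin n → ℝ)
    {U H : ι → Matrix (Fin n) (Fin n) ℝ} (hU : ∀ s i j, j < i → U s i j = 0)
    (hU0 : ∀ s, (U s).det ≠ 0) (hH : ∀ s, (H s).det ≠ 0) :
    logMinorSum w (fun s => (H s * U s)ᵀ * (H s * U s)) =
      logMinorSum w (fun s => (U s)ᵀ * U s) + logMinorSum w (fun s => (H s)ᵀ * H s) := by
  simp only [logMinorSum, ← Finset.sum_add_distrib, ← mul_add]
  refine Finset.sum_congr rfl fun s _ => Finset.sum_congr rfl fun m _ => ?_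
  congr 1
  have h1 : (H s * U s)ᵀ * (H s * U s) = (U s)ᵀ * ((H s)ᵀ * H s) * U s := by
    simp only [transpose_mul, Matrix.mul_assoc]
  have h2 : (U s)ᵀ * U s = (U s)ᵀ * 1 * U s := by rw [Matrix.mul_one]
  have h3 := det_leading_upper_ne_zero m (hU s) (hU0 s)
  have h4 := (posDef_leading m (hH s)).det_pos
  have h5 : (leading m (1 : Matrix (Fin n) (Fin n) ℝ)).det = 1 := by
    rw [leading, submatrix_one _ Subtype.val_injective, det_one]
  rw [h1, h2, leading_upper_conj m (hU s), leading_upper_conj m (hU s)]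
  simp only [det_mul, det_transpose, h5, mul_one]
  rw [← Real.log_mul (mul_ne_zero h3 h3) h4.ne']
  congr 1
  ring

lemma continuousAt_logMinorSum {ι : Type*} [Fintype ι] {n : ℕ} (w : ι → Fin n → ℝ)
    (S : Matrix (Fin n) (Fin n) ℝ) {Q : ι → Matrix (Fin n) (Fin n) ℝ}
    (hQ : ∀ s, (S * Q s).det ≠ 0) :
    ContinuousAt (fun Q : ι → Matrix (Fin n) (Fin n) ℝ =>
      logMinorSum w fun s => (S * Q s)ᵀ * (S * Q s)) Q := by
  refine tendsto_finsetSum _ fun s _ => tendsto_finsetSum _ fun m _ => ?_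
  refine Filter.Tendsto.const_mul _ (Filter.Tendsto.log ?_ (posDef_leading m (hQ s)).det_pos.ne')
  have : Continuous fun Q : ι → Matrix (Fin n) (Fin n) ℝ =>
      (leading m ((S * Q s)ᵀ * (S * Q s))).det := by
    refine Continuous.matrix_det (Continuous.matrix_submatrix (by fun_prop) _ _)
  exact this.continuousAt

lemma exists_stable_orthogonal {ι : Type*} [Fintype ι] {n : ℕ} (w : ι → Fin n → ℝ)
    {G : ι → Matrix (Fin n) (Fin n) ℝ} (hG : ∀ s, (G s).det ≠ 0) {C : ℝ}
    (hC : ∀ k : Matrix (Fin n) (Fin n) ℝ, k.det ≠ 0 →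
      C ≤ logMinorSum w fun s => (k * G s)ᵀ * (k * G s)) :
    ∃ Q : ι → Matrix (Fin n) (Fin n) ℝ, (∀ s, (Q s)ᵀ * Q s = 1) ∧
      ∀ S : Matrix (Fin n) (Fin n) ℝ, S.det ≠ 0 →
        0 ≤ logMinorSum w fun s => (S * Q s)ᵀ * (S * Q s) := by
  set f : Matrix (Fin n) (Fin n) ℝ → ℝ :=
    fun k => logMinorSum w fun s => (k * G s)ᵀ * (k * G s) with hf
  set T : Set ℝ := f '' {k | k.det ≠ 0} with hT
  have hTb : BddBelow T := ⟨C, by rintro _ ⟨k, hk, rfl⟩; exact hC k hk⟩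
  have hTn : T.Nonempty := ⟨f 1, 1, by simp, rfl⟩
  have hstep : ∀ ε : ℝ, 0 < ε → ∃ Q : ι → Matrix (Fin n) (Fin n) ℝ, (∀ s, (Q s)ᵀ * Q s = 1) ∧
      ∀ S : Matrix (Fin n) (Fin n) ℝ, S.det ≠ 0 →
        -ε ≤ logMinorSum w fun s => (S * Q s)ᵀ * (S * Q s) := by
    intro ε hε
    obtain ⟨_, ⟨k, hk, rfl⟩, hlt⟩ := Real.lt_sInf_add_pos hTn hε
    choose Q U hQ hQU hU using fun s => exists_orthogonal_mul_upper (k * G s)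
    have hdet : ∀ s, (Q s).det ≠ 0 ∧ (U s).det ≠ 0 := by
      intro s
      have h1 : (k * G s).det ≠ 0 := by
        rw [det_mul]
        exact mul_ne_zero hk (hG s)
      rw [hQU, det_mul] at h1
      exact mul_ne_zero_iff.mp h1
    refine ⟨Q, hQ, fun S hS => ?_⟩
    have h2 : f (S * k) = logMinorSum w (fun s => (U s)ᵀ * U s) +
        logMinorSum w (fun s => (S * Q s)ᵀ * (S * Q s)) := by
      rw [← logMinorSum_upper_conj w hU (fun s => (hdet s).2) fun s => by
        rw [det_mul]; exact mul_ne_zero hS (hdet s).1]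
      simp only [hf, Matrix.mul_assoc, hQU]
    have h3 : f k = logMinorSum w (fun s => (U s)ᵀ * U s) := by
      simp only [hf, hQU]
      congr 1
      funext s
      rw [transpose_mul, Matrix.mul_assoc, ← Matrix.mul_assoc (Q s)ᵀ, hQ, Matrix.one_mul]
    have h4 : sInf T ≤ f (S * k) := csInf_le hTb ⟨S * k, by
      rw [Set.mem_ofPred_eq, det_mul]; exact mul_ne_zero hS hk, rfl⟩
    linarith
  choose Q hQ hQS using fun j : ℕ => hstep (1 / ((j : ℝ) + 1)) (by positivity)
  have hK : IsCompact (Set.univ.pi fun _ : ι => {Q : Matrix (Fin n) (Fin n) ℝ | Qᵀ * Q = 1}) :=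
    isCompact_univ_pi fun _ => isCompact_orthogonal n
  have : FirstCountableTopology (Matrix (Fin n) (Fin n) ℝ) :=
    inferInstanceAs (FirstCountableTopology (Fin n → Fin n → ℝ))
  obtain ⟨Q', hQ', φ, hφ, hlim⟩ := hK.tendsto_subseq (x := Q) fun j s _ => hQ j s
  have hQ'' : ∀ s, (Q' s)ᵀ * Q' s = 1 := fun s => hQ' s (Set.mem_univ s)
  refine ⟨Q', hQ'', fun S hS => ?_⟩
  have hcont := continuousAt_logMinorSum w S (Q := Q') fun s => by
    rw [det_mul]
    refine mul_ne_zero hS fun h => ?_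
    have := det_sq_of_orthogonal (hQ'' s)
    rw [h] at this
    norm_num at this
  have h1 := hcont.tendsto.comp hlim
  have h2 : Filter.Tendsto (fun j : ℕ => -(1 / (((φ j : ℕ) : ℝ) + 1))) Filter.atTop (nhds 0) := by
    have := (tendsto_one_div_add_atTop_nhds_zero_nat (𝕜 := ℝ)).comp hφ.tendsto_atTop
    simpa using this.neg
  exact le_of_tendsto_of_tendsto' h2 h1 fun j => hQS (φ j) S hS

lemma sum_sq_col_eq_one {n : ℕ} {R : Matrix (Fin n) (Fin n) ℝ} (hR : Rᵀ * R = 1) (i : Fin n) :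
    ∑ l, R l i ^ 2 = 1 := by
  have h := congrFun (congrFun hR i) i
  rw [Matrix.mul_apply, one_apply_eq] at h
  rw [← h]
  exact Finset.sum_congr rfl fun l _ => sq _

lemma sum_sq_row_eq_one {n : ℕ} {R : Matrix (Fin n) (Fin n) ℝ} (hR : Rᵀ * R = 1) (l : Fin n) :
    ∑ i, R l i ^ 2 = 1 :=
  sum_sq_col_eq_one (R := Rᵀ) (by rw [transpose_transpose]; exact mul_eq_one_comm.mp hR) l

lemma log_det_leading_conj_le {n : ℕ} (m : Fin n) {R : Matrix (Fin n) (Fin n) ℝ}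
    (hR : Rᵀ * R = 1) (μ : Fin n → ℝ) :
    Real.log (leading m (Rᵀ * diagonal (fun l => Real.exp (μ l)) * R)).det ≤
      ∑ i : {i : Fin n // i ≤ m}, ∑ l, R l i.1 ^ 2 * (Real.exp (μ l) - 1) := by
  have hdet : R.det ≠ 0 := fun h => by
    have := det_sq_of_orthogonal hR
    rw [h] at this
    norm_num at this
  have h1 : Rᵀ * diagonal (fun l => Real.exp (μ l)) * R =
      (diagonal (fun l => Real.exp (μ l / 2)) * R)ᵀ *
        (diagonal (fun l => Real.exp (μ l / 2)) * R) := by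
    rw [transpose_mul, diagonal_transpose, Matrix.mul_assoc, Matrix.mul_assoc,
      ← Matrix.mul_assoc (diagonal _) (diagonal _), diagonal_mul_diagonal]
    simp only [← Real.exp_add, add_halves]
  have h2 : (diagonal (fun l => Real.exp (μ l / 2)) * R).det ≠ 0 := by
    rw [det_mul, det_diagonal]
    exact mul_ne_zero (Finset.prod_ne_zero_iff.mpr fun l _ => (Real.exp_pos _).ne') hdet
  have h3 := log_det_le_trace_sub_card (h1 ▸ posDef_leading m h2)
  refine h3.trans (le_of_eq ?_)
  have h4 : (Fintype.card {i : Fin n // i ≤ m} : ℝ) =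
      ∑ i : {i : Fin n // i ≤ m}, ∑ l, R l i.1 ^ 2 := by
    simp [sum_sq_col_eq_one hR]
  rw [h4, trace, ← Finset.sum_sub_distrib]
  refine Finset.sum_congr rfl fun i _ => ?_
  rw [diag_apply, leading, submatrix_apply, Matrix.mul_apply, ← Finset.sum_sub_distrib]
  refine Finset.sum_congr rfl fun l _ => ?_
  rw [mul_diagonal, transpose_apply]
  ring

lemma sum_weighted_diag_eq_zero {ι : Type*} [Fintype ι] {n : ℕ} {w : ι → Fin n → ℝ}
    (hw0 : ∀ s m, m.val + 1 < n → 0 ≤ w s m) {Q : ι → Matrix (Fin n) (Fin n) ℝ}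
    (hQ : ∀ s, (Q s)ᵀ * Q s = 1)
    (hmin : ∀ S : Matrix (Fin n) (Fin n) ℝ, S.det ≠ 0 →
        0 ≤ logMinorSum w fun s => (S * Q s)ᵀ * (S * Q s))
    {O : Matrix (Fin n) (Fin n) ℝ} (hO : Oᵀ * O = 1) {μ : Fin n → ℝ} (hμ : ∑ l, μ l = 0) :
    ∑ s, ∑ m, w s m * ∑ i : {i : Fin n // i ≤ m}, ∑ l, (Oᵀ * Q s) l i.1 ^ 2 * μ l = 0 := by
  have hO' : O * Oᵀ = 1 := mul_eq_one_comm.mp hO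
  have hR : ∀ s, (Oᵀ * Q s)ᵀ * (Oᵀ * Q s) = 1 := fun s => by
    rw [transpose_mul, transpose_transpose, Matrix.mul_assoc, ← Matrix.mul_assoc O, hO',
      Matrix.one_mul, hQ]
  set w' : ι → Fin n → ℝ := fun s m => if m.val + 1 < n then w s m else 0 with hw'
  set h : ℝ → ℝ := fun t => ∑ s, ∑ m, w' s m * ∑ i : {i : Fin n // i ≤ m}, ∑ l,
    (Oᵀ * Q s) l i.1 ^ 2 * (Real.exp (t * μ l) - 1) with hh
  have hnn : ∀ t, 0 ≤ h t := by
    intro t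
    have hS : (diagonal (fun l => Real.exp (t * μ l / 2)) * Oᵀ).det ≠ 0 := by
      rw [det_mul, det_diagonal, det_transpose]
      refine mul_ne_zero (Finset.prod_ne_zero_iff.mpr fun l _ => (Real.exp_pos _).ne') fun h => ?_
      have := det_sq_of_orthogonal hO
      rw [h] at this
      norm_num at this
    refine (hmin _ hS).trans (Finset.sum_le_sum fun s _ => Finset.sum_le_sum fun m _ => ?_)
    have h1 : (diagonal (fun l => Real.exp (t * μ l / 2)) * Oᵀ * Q s)ᵀ *
        (diagonal (fun l => Real.exp (t * μ l / 2)) * Oᵀ * Q s) =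
        (Oᵀ * Q s)ᵀ * diagonal (fun l => Real.exp (t * μ l)) * (Oᵀ * Q s) := by
      rw [Matrix.mul_assoc, transpose_mul, diagonal_transpose, Matrix.mul_assoc, Matrix.mul_assoc,
        ← Matrix.mul_assoc (diagonal _) (diagonal _), diagonal_mul_diagonal]
      simp only [← Real.exp_add, add_halves]
    simp only [h1, hw']
    split_ifs with hm
    · exact mul_le_mul_of_nonneg_left (log_det_leading_conj_le m (hR s) _) (hw0 s m hm)
    · rw [det_leading_last hm, det_mul, det_mul, det_transpose, det_diagonal, ← Real.exp_sum,
        ← Finset.mul_sum, hμ, mul_zero, Real.exp_zero, mul_one, ← sq, det_sq_of_orthogonal (hR s)]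
      simp
  have h0 : h 0 = 0 := by simp [hh]
  have hder : HasDerivAt h (∑ s, ∑ m, w' s m * ∑ i : {i : Fin n // i ≤ m}, ∑ l,
      (Oᵀ * Q s) l i.1 ^ 2 * μ l) 0 := by
    refine HasDerivAt.fun_sum fun s _ => HasDerivAt.fun_sum fun m _ => HasDerivAt.const_mul _ ?_
    refine HasDerivAt.fun_sum fun i _ => HasDerivAt.fun_sum fun l _ => HasDerivAt.const_mul _ ?_
    have := ((hasDerivAt_mul_const (x := (0 : ℝ)) (μ l)).exp).sub_const 1
    simpa using this
  have hloc : IsLocalMin h 0 := Filter.Eventually.of_forall fun t => h0.le.trans (hnn t)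
  have hz := hloc.hasDerivAt_eq_zero hder
  rw [← hz]
  refine Finset.sum_congr rfl fun s _ => Finset.sum_congr rfl fun m _ => ?_
  by_cases hm : m.val + 1 < n
  · simp only [hw', if_pos hm]
  · have hall : ∀ i : Fin n, i ≤ m := fun i => Fin.le_def.mpr (by omega)
    have h2 : ∑ i : {i : Fin n // i ≤ m}, ∑ l, (Oᵀ * Q s) l i.1 ^ 2 * μ l = 0 := by
      have h3 := Fintype.sum_equiv (Equiv.subtypeUnivEquiv hall)
        (fun i : {i : Fin n // i ≤ m} => ∑ l, (Oᵀ * Q s) l i.1 ^ 2 * μ l)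
        (fun i => ∑ l, (Oᵀ * Q s) l i ^ 2 * μ l) (fun _ => rfl)
      rw [h3, Finset.sum_comm]
      simp_rw [← Finset.sum_mul, sum_sq_row_eq_one (hR s), one_mul]
      exact hμ
    rw [h2, mul_zero, mul_zero]

lemma sum_mul_eq_sum_weights {n : ℕ} {σ w : Fin n → ℝ}
    (hw : ∀ i, σ i = ∑ m : Fin n, if i ≤ m then w m else 0) (d : Fin n → ℝ) :
    ∑ i, d i * σ i = ∑ m, w m * ∑ i : {i : Fin n // i ≤ m}, d i.1 := by
  simp_rw [hw, Finset.mul_sum]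
  rw [Finset.sum_comm]
  refine Finset.sum_congr rfl fun m _ => ?_
  rw [← Finset.sum_subtype (Finset.univ.filter fun i : Fin n => i ≤ m) (p := fun i => i ≤ m)
    (by simp) fun i => w m * d i, Finset.sum_filter]
  refine Finset.sum_congr rfl fun i _ => ?_
  split_ifs <;> ring

lemma sum_conj_diagonal_eq_zero {ι : Type*} [Fintype ι] {n : ℕ} {σ w : ι → Fin n → ℝ}
    (hw : ∀ s i, σ s i = ∑ m : Fin n, if i ≤ m then w s m else 0)
    (hw0 : ∀ s m, m.val + 1 < n → 0 ≤ w s m) (hsum : ∑ s, ∑ i, σ s i = 0)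
    {Q : ι → Matrix (Fin n) (Fin n) ℝ} (hQ : ∀ s, (Q s)ᵀ * Q s = 1)
    (hmin : ∀ S : Matrix (Fin n) (Fin n) ℝ, S.det ≠ 0 →
        0 ≤ logMinorSum w fun s => (S * Q s)ᵀ * (S * Q s)) :
    ∑ s, Q s * diagonal (σ s) * (Q s)ᵀ = 0 := by
  set M := ∑ s, Q s * diagonal (σ s) * (Q s)ᵀ with hM
  have hMs : M.IsSymm := by
    rw [Matrix.IsSymm, hM, transpose_sum]
    refine Finset.sum_congr rfl fun s _ => ?_
    simp [transpose_mul, Matrix.mul_assoc]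
  obtain ⟨O, μ, hO, hOM⟩ := exists_orthogonal_diagonalization hMs
  have htr : M.trace = 0 := by
    rw [hM, trace_sum, ← hsum]
    refine Finset.sum_congr rfl fun s _ => ?_
    rw [trace_mul_comm, ← Matrix.mul_assoc, hQ, Matrix.one_mul, trace_diagonal]
  have hμ : ∑ l, μ l = 0 := by
    rw [← htr, hOM, trace_mul_comm, ← Matrix.mul_assoc, hO, Matrix.one_mul, trace_diagonal]
  have hz := sum_weighted_diag_eq_zero hw0 hQ hmin hO hμ
  have hd : ∀ s i, ((Q s)ᵀ * M * Q s) i i = ∑ l, (Oᵀ * Q s) l i ^ 2 * μ l := by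
    intro s i
    have h1 : (Q s)ᵀ * M * Q s = (Oᵀ * Q s)ᵀ * diagonal μ * (Oᵀ * Q s) := by
      rw [hOM, transpose_mul, transpose_transpose]
      simp only [Matrix.mul_assoc]
    rw [h1, Matrix.mul_apply]
    refine Finset.sum_congr rfl fun l _ => ?_
    rw [mul_diagonal, transpose_apply]
    ring
  have hMM : (M * M).trace = 0 := by
    rw [← hz]
    nth_rw 2 [hM]
    rw [Matrix.mul_sum, trace_sum]
    refine Finset.sum_congr rfl fun s _ => ?_
    have h1 : (M * (Q s * diagonal (σ s) * (Q s)ᵀ)).trace =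
        ((Q s)ᵀ * M * Q s * diagonal (σ s)).trace := by
      rw [← Matrix.mul_assoc, trace_mul_comm]
      simp only [Matrix.mul_assoc]
    rw [h1, trace]
    simp_rw [diag_apply, mul_diagonal, hd]
    exact sum_mul_eq_sum_weights (hw s) _
  have := (trace_conjTranspose_mul_self_eq_zero_iff (A := M)).mp (by
    rw [conjTranspose_eq_transpose_of_trivial, hMs.eq, hMM])
  exact this

theorem exists_balanced {ι : Type*} [Fintype ι] {n : ℕ}
    (b : ι → Module.Basis (Fin n) ℝ (Fin n → ℝ)) {σ : ι → Fin n → ℝ} (hσ : ∀ s, Antitone (σ s))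
    (hsum : ∑ s, ∑ i, σ s i = 0) (hss : ∀ V, degree (fun s => b s) σ V ≤ 0) :
    ∃ Q : ι → Matrix (Fin n) (Fin n) ℝ, (∀ s, (Q s)ᵀ * Q s = 1) ∧
      ∑ s, Q s * diagonal (σ s) * (Q s)ᵀ = 0 := by
  choose w hw1 hw using fun s => exists_weights (σ s)
  have hw0 : ∀ s m, m.val + 1 < n → 0 ≤ w s m := fun s m hm => by
    rw [hw1 s m hm]
    exact sub_nonneg.mpr (hσ s (Fin.le_def.mpr (Nat.le_succ _)))
  set G : ι → Matrix (Fin n) (Fin n) ℝ := fun s => Matrix.of fun i j => b s j i with hG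
  have hG0 : ∀ s, (G s).det ≠ 0 := by
    intro s h
    obtain ⟨v, hv, hv0⟩ := Matrix.exists_mulVec_eq_zero_iff.mpr h
    refine hv (funext (Fintype.linearIndependent_iff.mp (b s).linearIndependent v ?_))
    rw [← hv0]
    ext i
    simp [hG, mulVec, dotProduct, mul_comm]
  obtain ⟨C, hC⟩ := exists_lower_bound_logMinorSum b hw hw0 hsum hss (G := G) (fun s => rfl) hG0
  obtain ⟨Q, hQ, hmin⟩ := exists_stable_orthogonal w hG0 (C := C) fun k hk => by
    have hsymm : (kᵀ * k).IsSymm := by simp [Matrix.IsSymm, transpose_mul]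
    obtain ⟨P, μ, hP, hμ, hk'⟩ := exists_orthogonal_diagonalization_antitone hsymm
    have hpd : (diagonal μ).PosDef := by
      have h1 : diagonal μ = (k * P)ᴴ * (k * P) := by
        rw [conjTranspose_eq_transpose_of_trivial, transpose_mul, Matrix.mul_assoc,
          ← Matrix.mul_assoc kᵀ, hk']
        simp only [Matrix.mul_assoc, hP, Matrix.mul_one]
        rw [← Matrix.mul_assoc, hP, Matrix.one_mul]
      rw [h1]
      refine PosDef.conjTranspose_mul_self _
        (mulVec_injective_iff_isUnit.mpr ((isUnit_iff_isUnit_det _).mpr ?_))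
      rw [det_mul]
      exact hk.isUnit.mul ((isUnit_iff_isUnit_det _).mp (.of_mul_eq_one_right _ hP))
    have hμ0 : ∀ i, 0 < μ i := posDef_diagonal_iff.mp hpd
    have h2 := hC Pᵀ μ (by rw [transpose_transpose]; exact mul_eq_one_comm.mp hP) hμ hμ0
    have h3 : ∀ s, (Pᵀ * G s)ᵀ * diagonal μ * (Pᵀ * G s) = (k * G s)ᵀ * (k * G s) := by
      intro s
      calc (Pᵀ * G s)ᵀ * diagonal μ * (Pᵀ * G s) = (G s)ᵀ * (P * diagonal μ * Pᵀ) * G s := by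
            simp only [transpose_mul, transpose_transpose, Matrix.mul_assoc]
        _ = (k * G s)ᵀ * (k * G s) := by
            rw [← hk', transpose_mul]
            simp only [Matrix.mul_assoc]
    simp only [h3] at h2
    exact h2
  exact ⟨Q, hQ, sum_conj_diagonal_eq_zero hw hw0 hsum hQ hmin⟩

lemma antitone_eq_of_prod_X_sub_C_eq {n : ℕ} {μ σ : Fin n → ℝ} (hμ : Antitone μ)
    (hσ : Antitone σ)
    (h : ∏ i, (Polynomial.X - Polynomial.C (μ i)) = ∏ i, (Polynomial.X - Polynomial.C (σ i))) :
    μ = σ := by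
  have key : ∀ f : Fin n → ℝ, (∏ i, (Polynomial.X - Polynomial.C (f i))).roots =
      (List.ofFn f : Multiset ℝ) := by
    intro f
    rw [← Fin.univ_val_map, ← Polynomial.roots_multiset_prod_X_sub_C
      (Multiset.map f Finset.univ.val), Multiset.map_map]
    rfl
  have hp : (List.ofFn μ).Perm (List.ofFn σ) := by
    rw [← Multiset.coe_eq_coe, ← key, ← key, h]
  exact List.ofFn_injective (hp.eq_of_sortedGE hμ.sortedGE_ofFn hσ.sortedGE_ofFn)

lemma exists_orthogonal_of_charpoly {n : ℕ} {A : Matrix (Fin n) (Fin n) ℝ} (hA : A.IsSymm)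
    {σ : Fin n → ℝ} (hσ : Antitone σ)
    (h : A.charpoly = ∏ i, (Polynomial.X - Polynomial.C (σ i))) :
    ∃ Q : Matrix (Fin n) (Fin n) ℝ, Qᵀ * Q = 1 ∧ A = Q * diagonal σ * Qᵀ := by
  obtain ⟨Q, μ, hQ, hμ, hA'⟩ := exists_orthogonal_diagonalization_antitone hA
  rw [hA', charpoly_orthogonal_conj hQ] at h
  obtain rfl := antitone_eq_of_prod_X_sub_C_eq hμ hσ h
  exact ⟨Q, hQ, hA'⟩

lemma prod_interleave {M : Type*} [CommMonoid M] {p : ℕ} (f : Fin (2 * p) → M) :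
    ∏ j, f j = (∏ i, f (interleave p (Sum.inl i))) * ∏ i, f (interleave p (Sum.inr i)) := by
  rw [← (interleave p).prod_comp, Fintype.prod_sum_type]

lemma sum_interleave {p : ℕ} (f : Fin (2 * p) → ℝ) :
    ∑ j, f j = ∑ i, f (interleave p (Sum.inl i)) + ∑ i, f (interleave p (Sum.inr i)) := by
  rw [← (interleave p).sum_comp, Fintype.sum_sum_type]

lemma half_interleave_inl {p : ℕ} (i : Fin p) (h) :
    (⟨(interleave p (Sum.inl i)).val / 2, h⟩ : Fin p) = i := by
  ext
  simp

lemma half_interleave_inr {p : ℕ} (i : Fin p) (h) :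
    (⟨(interleave p (Sum.inr i)).val / 2, h⟩ : Fin p) = i := by
  ext
  simp only [val_interleave_inr]
  omega

lemma isSymm_conj_diagonal {n : ℕ} (Q : Matrix (Fin n) (Fin n) ℝ) (μ : Fin n → ℝ) :
    (Q * diagonal μ * Qᵀ).IsSymm := by
  simp [Matrix.IsSymm, transpose_mul, Matrix.mul_assoc]

lemma trace_conj_diagonal {n : ℕ} {Q : Matrix (Fin n) (Fin n) ℝ} (hQ : Qᵀ * Q = 1)
    (μ : Fin n → ℝ) : (Q * diagonal μ * Qᵀ).trace = ∑ i, μ i := by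
  rw [trace_mul_comm, ← Matrix.mul_assoc, hQ, Matrix.one_mul, trace_diagonal]

/-- The two interleaved block-diagonal sums of `a` and `b` have the spectrum of `a ⊕ b`. -/
lemma exists_doubled {p : ℕ} {σ : Fin (2 * p) → ℝ} {ν : Fin p → ℝ}
    {a b : Matrix (Fin p) (Fin p) ℝ} (ha : a.IsSymm) (hb : b.IsSymm)
    (hac : a.charpoly = ∏ i,
      (Polynomial.X - Polynomial.C (σ (interleave p (Sum.inl i)))))
    (hbc : b.charpoly = ∏ i,
      (Polynomial.X - Polynomial.C (σ (interleave p (Sum.inr i)))))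
    (habc : (a + b).charpoly = ∏ i, (Polynomial.X - Polynomial.C (ν i))) :
    ∃ A B : Matrix (Fin (2 * p)) (Fin (2 * p)) ℝ, A.IsSymm ∧ B.IsSymm ∧
      A.charpoly = ∏ i, (Polynomial.X - Polynomial.C (σ i)) ∧
      B.charpoly = ∏ i, (Polynomial.X - Polynomial.C (σ i)) ∧
      (A + B).charpoly = ∏ i, (Polynomial.X - Polynomial.C (ν i)) ^ 2 := by
  have hsymm : ∀ c d : Matrix (Fin p) (Fin p) ℝ, c.IsSymm → d.IsSymm →
      (reindex (interleave p) (interleave p) (fromBlocks c 0 0 d)).IsSymm := by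
    intro c d hc hd
    rw [Matrix.IsSymm, transpose_reindex, fromBlocks_transpose, hc.eq, hd.eq]
    simp
  have hchar : ∀ c d : Matrix (Fin p) (Fin p) ℝ,
      (reindex (interleave p) (interleave p) (fromBlocks c 0 0 d)).charpoly =
        c.charpoly * d.charpoly := by
    intro c d
    rw [charpoly_reindex, charpoly_fromBlocks_zero₁₂]
  refine ⟨reindex (interleave p) (interleave p) (fromBlocks a 0 0 b),
    reindex (interleave p) (interleave p) (fromBlocks b 0 0 a), hsymm a b ha hb, hsymm b a hb ha,
    ?_, ?_, ?_⟩
  · rw [hchar, hac, hbc, prod_interleave]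
  · rw [hchar, hac, hbc, prod_interleave, mul_comm]
  · have : reindex (interleave p) (interleave p) (fromBlocks a 0 0 b) +
        reindex (interleave p) (interleave p) (fromBlocks b 0 0 a) =
        reindex (interleave p) (interleave p) (fromBlocks (a + b) 0 0 (a + b)) := by
      have h : fromBlocks (a + b) 0 0 (a + b) = fromBlocks a 0 0 b + fromBlocks b 0 0 a := by
        rw [fromBlocks_add, add_comm b a, add_zero]
      rw [h]
      rfl
    rw [this, hchar, habc, ← sq, Finset.prod_pow]

lemma exists_halved {p : ℕ} {σ : Fin (2 * p) → ℝ} (hσ : Antitone σ) {ν : Fin p → ℝ}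
    (hν : Antitone ν) {A B : Matrix (Fin (2 * p)) (Fin (2 * p)) ℝ} (hA : A.IsSymm) (hB : B.IsSymm)
    (hAc : A.charpoly = ∏ i, (Polynomial.X - Polynomial.C (σ i)))
    (hBc : B.charpoly = ∏ i, (Polynomial.X - Polynomial.C (σ i)))
    (hABc : (A + B).charpoly = ∏ i, (Polynomial.X - Polynomial.C (ν i)) ^ 2) :
    ∃ a b : Matrix (Fin p) (Fin p) ℝ, a.IsSymm ∧ b.IsSymm ∧
      a.charpoly = ∏ i, (Polynomial.X - Polynomial.C (σ (interleave p (Sum.inl i)))) ∧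
      b.charpoly = ∏ i, (Polynomial.X - Polynomial.C (σ (interleave p (Sum.inr i)))) ∧
      (a + b).charpoly = ∏ i, (Polynomial.X - Polynomial.C (ν i)) := by
  obtain ⟨P, hP, hAP⟩ := exists_orthogonal_of_charpoly hA hσ hAc
  obtain ⟨P', hP', hBP⟩ := exists_orthogonal_of_charpoly hB hσ hBc
  have hν2 : Antitone fun j : Fin (2 * p) => ν ⟨j.val / 2, by omega⟩ :=
    fun i j hij => hν (Fin.mk_le_mk.mpr (Nat.div_le_div_right hij))
  obtain ⟨R, hR, hABR⟩ := exists_orthogonal_of_charpoly (A := A + B)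
    (by rw [Matrix.IsSymm, transpose_add, hA.eq, hB.eq]) hν2 (by
      rw [hABc, prod_interleave]
      simp only [half_interleave_inl, half_interleave_inr]
      rw [← sq, Finset.prod_pow])
  set τ : Fin p → ℝ := fun i => -ν i.rev
  have hτa : Antitone τ := fun i j hij => neg_le_neg (hν (Fin.rev_le_rev.mpr hij))
  have hR' := orthogonal_submatrix hR Fin.revPerm
  have hABR' : A + B = - (R.submatrix id Fin.revPerm * diagonal
      (fun j : Fin (2 * p) => τ ⟨j.val / 2, by omega⟩) * (R.submatrix id Fin.revPerm)ᵀ) := by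
    have hrev : ((fun j : Fin (2 * p) => ν ⟨j.val / 2, by omega⟩) ∘ Fin.revPerm) =
        fun j : Fin (2 * p) => -τ ⟨j.val / 2, by omega⟩ := by
      funext j
      change ν _ = - -ν _
      rw [neg_neg]
      congr 1
      apply Fin.ext
      change (2 * p - (j.val + 1)) / 2 = p - (j.val / 2 + 1)
      omega
    have hdiag : diagonal (fun j : Fin (2 * p) => -τ ⟨j.val / 2, by omega⟩) =
        -diagonal (fun j : Fin (2 * p) => τ ⟨j.val / 2, by omega⟩) :=
      (diagonal_neg _).symm
    rw [hABR, ← conj_diagonal_submatrix R _ Fin.revPerm, hrev, hdiag, Matrix.mul_neg,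
      Matrix.neg_mul]
  set Q : Fin 3 → Matrix (Fin (2 * p)) (Fin (2 * p)) ℝ :=
    ![P, P', R.submatrix id Fin.revPerm] with hQdef
  have hQ : ∀ s, (Q s)ᵀ * Q s = 1 := by
    intro s
    fin_cases s
    · exact hP
    · exact hP'
    · exact hR'
  have hbal : ∑ s, Q s * diagonal ((![σ, σ, fun j => τ ⟨j.val / 2, by omega⟩] : Fin 3 → _) s)
      * (Q s)ᵀ = 0 := by
    rw [Fin.sum_univ_three]
    change P * diagonal σ * Pᵀ + P' * diagonal σ * P'ᵀ + _ = 0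
    rw [← hAP, ← hBP, hABR']
    exact neg_add_cancel _
  have htr : ∑ s, ∑ i, (![fun i => σ (interleave p (Sum.inl i)),
      fun i => σ (interleave p (Sum.inr i)), τ] : Fin 3 → Fin p → ℝ) s i = 0 := by
    have h1 := congrArg trace hbal
    rw [trace_sum, trace_zero] at h1
    simp only [trace_conj_diagonal (hQ _)] at h1
    rw [Fin.sum_univ_three] at h1 ⊢
    have h2 := sum_interleave fun j : Fin (2 * p) => τ ⟨j.val / 2, by omega⟩
    simp only [half_interleave_inl, half_interleave_inr] at h2
    have h3 := sum_interleave σ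
    simp only [Matrix.cons_val] at h1 ⊢
    linarith
  obtain ⟨b, hb⟩ := exists_generic_bases (Fin 3) p
  have hss := degree_nonpos_of_doubled b hb hσ hτa hQ hbal
  obtain ⟨O, hO, hObal⟩ := exists_balanced b (by
    intro s
    fin_cases s
    · exact fun i j hij => hσ (Fin.le_def.mpr (Nat.mul_le_mul_left 2 hij))
    · exact fun i j hij => hσ (Fin.le_def.mpr (Nat.succ_le_succ (Nat.mul_le_mul_left 2 hij)))
    · exact hτa) htr hss
  rw [Fin.sum_univ_three] at hObal
  simp only [Matrix.cons_val] at hObal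
  refine ⟨_, _, isSymm_conj_diagonal (O 0) fun i => σ (interleave p (Sum.inl i)),
    isSymm_conj_diagonal (O 1) fun i => σ (interleave p (Sum.inr i)),
    charpoly_orthogonal_conj (hO 0) _, charpoly_orthogonal_conj (hO 1) _, ?_⟩
  have hneg : - (O 2 * diagonal τ * (O 2)ᵀ) = O 2 * diagonal (fun i => ν i.rev) * (O 2)ᵀ := by
    rw [← Matrix.neg_mul, ← Matrix.mul_neg, ← diagonal_neg]
    simp
  rw [eq_neg_of_add_eq_zero_left hObal, hneg, charpoly_orthogonal_conj (hO 2)]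
  exact Equiv.prod_comp Fin.revPerm fun i => Polynomial.X - Polynomial.C (ν i)

end HornDoubling

/-- main Theorem 2 of the paper: `𝒫₁ = 𝒫₂`. Given reals
`σ₁ ≥ ⋯ ≥ σ_{2p}`, the set `𝒫₁` of decreasing `p`-tuples `ν` that are the ordered
spectrum of a sum `a + b` of real symmetric `p × p` matrices with ordered spectra
`(σ₁, σ₃, …, σ_{2p-1})` and `(σ₂, σ₄, …, σ_{2p})` coincides with the set `𝒫₂` of
decreasing `p`-tuples `ν` whose doubled list `(ν₁, ν₁, …, ν_p, ν_p)` is the ordered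
spectrum of a sum `A + B` of real symmetric `2p × 2p` matrices each with ordered
spectrum `(σ₁, …, σ_{2p})`. -/
theorem P1_eq_P2
    (p : ℕ) (hp : 1 ≤ p)
    (σ : Fin (2 * p) → ℝ) (hσ : Antitone σ) :
    {ν : Fin p → ℝ | Antitone ν ∧
      ∃ a b : Matrix (Fin p) (Fin p) ℝ, a.IsSymm ∧ b.IsSymm ∧
        a.charpoly = ∏ i : Fin p,
          (Polynomial.X - Polynomial.C (σ ⟨2 * i.val, by have := i.isLt; omega⟩)) ∧
        b.charpoly = ∏ i : Fin p,
          (Polynomial.X - Polynomial.C (σ ⟨2 * i.val + 1, by have := i.isLt; omega⟩)) ∧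
        (a + b).charpoly = ∏ i : Fin p, (Polynomial.X - Polynomial.C (ν i))} =
    {ν : Fin p → ℝ | Antitone ν ∧
      ∃ A B : Matrix (Fin (2 * p)) (Fin (2 * p)) ℝ, A.IsSymm ∧ B.IsSymm ∧
        A.charpoly = ∏ i : Fin (2 * p), (Polynomial.X - Polynomial.C (σ i)) ∧
        B.charpoly = ∏ i : Fin (2 * p), (Polynomial.X - Polynomial.C (σ i)) ∧
        (A + B).charpoly = ∏ i : Fin p, (Polynomial.X - Polynomial.C (ν i)) ^ 2} := by
  ext ν
  constructor
  · rintro ⟨hν, a, b, ha, hb, hac, hbc, habc⟩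
    exact ⟨hν, HornDoubling.exists_doubled ha hb hac hbc habc⟩
  · rintro ⟨hν, A, B, hA, hB, hAc, hBc, hABc⟩
    exact ⟨hν, HornDoubling.exists_halved hσ hν hA hB hAc hBc hABc⟩
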